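/- arXiv:1907.01687 — 3 statements merged into one kernel-verified Lean document; each statement's English description precedes it below -/
import Mathlib

section
/- There exists a constant C > 0 depending only on d with the following property. Let u be a smooth solution of the heat equation ∂_t u = Δu on [−1,0] × ℝ^d, let x₀ ∈ ℝ^d, let k ≥ 1 be an integer, and let 1 ≤ j ≤ k − 1 be an integer. Set Ω¹_j = {(t,x) : |x − x₀| < j/√k, t ∈ [−j/k, 0]} and Ω²_j = {(t,x) : |x − x₀| < (j+0.5)/√k, t ∈ [−(j+0.5)/k, 0]}. Then ∫_{Ω¹_j} (∂_t u)² dx dt ≤ C k ∫_{Ω²_j} |∇u|² dx dt. -/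
open Real Set MeasureTheory

/-- The Laplacian of `f : ℝ^d → ℝ`: sum of second partial derivatives. -/
noncomputable def Lap {d : ℕ} (f : EuclideanSpace ℝ (Fin d) → ℝ)
    (x : EuclideanSpace ℝ (Fin d)) : ℝ :=
  ∑ i : Fin d,
    fderiv ℝ (fun y => fderiv ℝ f y (EuclideanSpace.single i 1)) x (EuclideanSpace.single i 1)

section Slices

variable {E : Type*} [NormedAddCommGroup E] [NormedSpace ℝ E]

lemma fderiv_slice_snd {F : ℝ × E → ℝ} {t : ℝ} {x : E} (hF : DifferentiableAt ℝ F (t, x))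
    (e : E) : fderiv ℝ (fun y => F (t, y)) x e = fderiv ℝ F (t, x) (0, e) := by
  have h := hF.hasFDerivAt.comp x (hasFDerivAt_prodMk_right t x)
  have h' := h.fderiv
  simp only [Function.comp_def] at h'
  rw [h']
  simp

lemma hasDerivAt_slice_fst {F : ℝ × E → ℝ} {t : ℝ} {x : E} (hF : DifferentiableAt ℝ F (t, x)) :
    HasDerivAt (fun s => F (s, x)) (fderiv ℝ F (t, x) (1, 0)) t := by
  exact hF.hasFDerivAt.comp_hasDerivAt t ((hasDerivAt_id t).prodMk (hasDerivAt_const t x))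

/-- A function smooth near a closed set agrees near that set with a globally smooth function. -/
lemma exists_contDiff_eventuallyEq_nhdsSet [FiniteDimensional ℝ E] {U K : Set E} {f : E → ℝ}
    (hU : IsOpen U) (hK : IsClosed K) (hKU : K ⊆ U) (hf : ContDiffOn ℝ (⊤ : ℕ∞) f U) :
    ∃ g : E → ℝ, ContDiff ℝ (⊤ : ℕ∞) g ∧ ∀ p ∈ K, g =ᶠ[nhds p] f := by
  obtain ⟨χ, h0, h1, -⟩ := exists_contMDiffMap_zero_one_nhds_of_isClosed (n := (⊤ : ℕ∞))
    (modelWithCornersSelf ℝ E) hU.isClosed_compl hK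
    (Set.disjoint_left.2 fun p hp hp' => hp (hKU hp'))
  have hχ : ContDiff ℝ (⊤ : ℕ∞) χ := χ.contMDiff.contDiff
  refine ⟨fun p => χ p * f p, contDiff_iff_contDiffAt.2 fun p => ?_, fun p hp => ?_⟩
  · by_cases hp : p ∈ U
    · exact hχ.contDiffAt.mul (hf.contDiffAt (hU.mem_nhds hp))
    · have h : ∀ᶠ q in nhds p, χ q = 0 := (eventually_nhdsSet_iff_forall.1 h0) p hp
      refine (contDiffAt_const (c := (0 : ℝ))).congr_of_eventuallyEq ?_
      filter_upwards [h] with q hq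
      simp [hq]
  · have h : ∀ᶠ q in nhds p, χ q = 1 := (eventually_nhdsSet_iff_forall.1 h1) p hp
    filter_upwards [h] with q hq
    simp [hq]

variable [FiniteDimensional ℝ E] [MeasurableSpace E] [BorelSpace E]

lemma integrableOn_Icc_prod_closedBall {μ : Measure E} [IsLocallyFiniteMeasure μ]
    {F : ℝ × E → ℝ} (hF : Continuous F) (a b : ℝ) (x₀ : E) (R : ℝ) :
    IntegrableOn F (Icc a b ×ˢ Metric.closedBall x₀ R) ((volume : Measure ℝ).prod μ) :=
  hF.continuousOn.integrableOn_compact (isCompact_Icc.prod (isCompact_closedBall x₀ R))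

lemma integral_fderiv_eq_zero_of_hasCompactSupport {μ : Measure E} [μ.IsAddHaarMeasure]
    {g : E → ℝ} (hg : ContDiff ℝ 1 g) (hs : HasCompactSupport g) (e : E) :
    ∫ x, fderiv ℝ g x e ∂μ = 0 := by
  have hc : Continuous fun x => fderiv ℝ g x e := (hg.continuous_fderiv one_ne_zero).clm_apply continuous_const
  have hi : Integrable (fun x => fderiv ℝ g x e) μ :=
    hc.integrable_of_hasCompactSupport (hs.fderiv_apply ℝ e)
  have h := integral_mul_fderiv_eq_neg_fderiv_mul_of_integrable (μ := μ) (f := fun _ : E => (1 : ℝ))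
    (g := g) (v := e) (by simp) (by simpa using hi)
    (by simpa using hg.continuous.integrable_of_hasCompactSupport hs)
    (fun x _ => by fun_prop) (fun x _ => hg.differentiable one_ne_zero x)
  simpa using h

lemma setIntegral_fderiv_snd_eq_zero {μ : Measure E} [μ.IsAddHaarMeasure]
    {G : ℝ × E → ℝ} (hG : ContDiff ℝ 1 G) {x₀ : E} {R : ℝ}
    (hs : ∀ t x, x ∉ Metric.closedBall x₀ R → G (t, x) = 0) (a b : ℝ) (e : E) :
    ∫ p in Icc a b ×ˢ Metric.closedBall x₀ R, fderiv ℝ G p (0, e) ∂((volume : Measure ℝ).prod μ)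
      = 0 := by
  have hc : Continuous fun p => fderiv ℝ G p (0, e) :=
    (hG.continuous_fderiv one_ne_zero).clm_apply continuous_const
  rw [setIntegral_prod _ (integrableOn_Icc_prod_closedBall hc a b x₀ R)]
  refine integral_eq_zero_of_ae (Filter.Eventually.of_forall fun t => ?_)
  have hg : ContDiff ℝ 1 fun y => G (t, y) := hG.comp (by fun_prop)
  have hgs : tsupport (fun y => G (t, y)) ⊆ Metric.closedBall x₀ R :=
    closure_minimal (fun x hx => by_contra fun h => hx (hs t x h)) Metric.isClosed_closedBall
  have h := integral_fderiv_eq_zero_of_hasCompactSupport (μ := μ) hg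
    ((isCompact_closedBall x₀ R).of_isClosed_subset (isClosed_tsupport _) hgs) e
  simp only [Pi.zero_apply]
  refine (setIntegral_congr_fun measurableSet_closedBall fun x _ =>
    (fderiv_slice_snd (hG.differentiable one_ne_zero (t, x)) e).symm).trans
    ((setIntegral_eq_integral_of_forall_compl_eq_zero fun x hx => ?_).trans h)
  have : fderiv ℝ (fun y => G (t, y)) x = 0 :=
    image_eq_zero_of_notMem_tsupport fun h' => hx (hgs (tsupport_fderiv_subset ℝ h'))
  rw [this]; rfl

lemma setIntegral_fderiv_fst {μ : Measure E} [IsLocallyFiniteMeasure μ] [SFinite μ]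
    {H : ℝ × E → ℝ} (hH : ContDiff ℝ 1 H) (x₀ : E) (R : ℝ) {a b : ℝ} (hab : a ≤ b) :
    ∫ p in Icc a b ×ˢ Metric.closedBall x₀ R, fderiv ℝ H p (1, 0) ∂((volume : Measure ℝ).prod μ)
      = ∫ x in Metric.closedBall x₀ R, (H (b, x) - H (a, x)) ∂μ := by
  have hc : Continuous fun p => fderiv ℝ H p (1, 0) :=
    (hH.continuous_fderiv one_ne_zero).clm_apply continuous_const
  have hi := integrableOn_Icc_prod_closedBall (μ := μ) hc a b x₀ R
  rw [IntegrableOn, ← Measure.prod_restrict] at hi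
  rw [← Measure.prod_restrict, integral_prod_symm _ hi]
  refine integral_congr_ae (Filter.Eventually.of_forall fun x => ?_)
  simp only
  rw [integral_Icc_eq_integral_Ioc, ← intervalIntegral.integral_of_le hab]
  refine intervalIntegral.integral_eq_sub_of_hasDerivAt
    (fun t _ => hasDerivAt_slice_fst (hH.differentiable one_ne_zero _)) ?_
  exact (hc.comp (by fun_prop : Continuous fun t : ℝ => (t, x))).intervalIntegrable _ _

end Slices

lemma exists_abs_deriv_smoothTransition_le :
    ∃ M > (0 : ℝ), ∀ s, |deriv Real.smoothTransition s| ≤ M := by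
  have hc : Continuous (deriv Real.smoothTransition) :=
    (Real.smoothTransition.contDiff (n := 1)).continuous_deriv le_rfl
  obtain ⟨M, hM⟩ := isCompact_Icc.exists_bound_of_continuousOn (s := Icc (0 : ℝ) 1) hc.continuousOn
  refine ⟨|M| + 1, by positivity, fun s => ?_⟩
  by_cases hs : s ∈ Icc (0 : ℝ) 1
  · exact (hM s hs).trans ((le_abs_self M).trans (by linarith))
  · have : deriv Real.smoothTransition s = 0 := by
      rcases not_and_or.1 hs with h | h
      · refine IsLocalMin.deriv_eq_zero (Filter.Eventually.of_forall fun y => ?_)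
        rw [Real.smoothTransition.zero_of_nonpos (not_le.1 h).le]
        exact Real.smoothTransition.nonneg y
      · refine IsLocalMax.deriv_eq_zero (Filter.Eventually.of_forall fun y => ?_)
        rw [Real.smoothTransition.one_of_one_le (not_le.1 h).le]
        exact Real.smoothTransition.le_one y
    rw [this, abs_zero]; positivity

lemma fderiv_fderiv_apply_comm {E : Type*} [NormedAddCommGroup E] [NormedSpace ℝ E] {w : E → ℝ}
    (hw : ContDiff ℝ (⊤ : ℕ∞) w) (p a b : E) :
    fderiv ℝ (fun q => fderiv ℝ w q a) p b = fderiv ℝ (fun q => fderiv ℝ w q b) p a := by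
  have hd : DifferentiableAt ℝ (fderiv ℝ w) p :=
    (hw.fderiv_right (m := (⊤ : ℕ∞)) (by simp)).differentiable (by simp) p
  have hsymm : IsSymmSndFDerivAt ℝ w p :=
    hw.contDiffAt.isSymmSndFDerivAt (by simpa using WithTop.coe_le_coe.2 (le_top : (2 : ℕ∞) ≤ ⊤))
  rw [fderiv_clm_apply hd (by fun_prop), fderiv_clm_apply hd (by fun_prop)]
  simpa using hsymm b a

section Cutoff

variable {E : Type*} [NormedAddCommGroup E] [NormedSpace ℝ E] {η : ℝ → ℝ} {ψ : E → ℝ}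

lemma fderiv_cutoff_fst (hη : ContDiff ℝ 1 η) (hψ : ContDiff ℝ 1 ψ) (p : ℝ × E) :
    fderiv ℝ (fun q : ℝ × E => η q.1 * ψ q.2 ^ 2) p (1, 0) = deriv η p.1 * ψ p.2 ^ 2 := by
  have h1 := (hη.differentiable one_ne_zero p.1).hasDerivAt.comp_hasFDerivAt p
    (hasFDerivAt_fst (𝕜 := ℝ) (E := ℝ) (F := E) (p := p))
  have h2 := ((hψ.differentiable one_ne_zero p.2).hasFDerivAt.comp p
    (hasFDerivAt_snd (𝕜 := ℝ) (E := ℝ) (F := E) (p := p))).pow 2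
  have h := (h1.mul h2).fderiv
  simp only [Function.comp_def] at h
  erw [h]
  simp
  ring

lemma fderiv_cutoff_snd (hη : ContDiff ℝ 1 η) (hψ : ContDiff ℝ 1 ψ) (p : ℝ × E) (e : E) :
    fderiv ℝ (fun q : ℝ × E => η q.1 * ψ q.2 ^ 2) p (0, e)
      = η p.1 * (2 * ψ p.2 * fderiv ℝ ψ p.2 e) := by
  have h1 := (hη.differentiable one_ne_zero p.1).hasDerivAt.comp_hasFDerivAt p
    (hasFDerivAt_fst (𝕜 := ℝ) (E := ℝ) (F := E) (p := p))
  have h2 := ((hψ.differentiable one_ne_zero p.2).hasFDerivAt.comp p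
    (hasFDerivAt_snd (𝕜 := ℝ) (E := ℝ) (F := E) (p := p))).pow 2
  have h := (h1.mul h2).fderiv
  simp only [Function.comp_def] at h
  erw [h]
  simp

end Cutoff

section Energy

variable {d : ℕ} {w : ℝ × EuclideanSpace ℝ (Fin d) → ℝ}
  {η : ℝ → ℝ} {ψ : EuclideanSpace ℝ (Fin d) → ℝ}

lemma contDiff_fderiv_apply {E : Type*} [NormedAddCommGroup E] [NormedSpace ℝ E] {w : E → ℝ}
    (hw : ContDiff ℝ (⊤ : ℕ∞) w) (e : E) : ContDiff ℝ (⊤ : ℕ∞) fun q => fderiv ℝ w q e :=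
  (hw.fderiv_right (m := (⊤ : ℕ∞)) (by exact_mod_cast le_top)).clm_apply contDiff_const

/-- The energy identity in divergence form, at a point where the heat equation holds. -/
lemma cutoff_mul_timeDeriv_sq_eq (hw : ContDiff ℝ (⊤ : ℕ∞) w) (hη : ContDiff ℝ 1 η)
    (hψ : ContDiff ℝ 1 ψ) (p : ℝ × EuclideanSpace ℝ (Fin d))
    (heat : fderiv ℝ w p (1, 0) = ∑ i, fderiv ℝ
      (fun q => fderiv ℝ w q (0, EuclideanSpace.single i 1)) p (0, EuclideanSpace.single i 1)) :
    η p.1 * ψ p.2 ^ 2 * fderiv ℝ w p (1, 0) ^ 2 =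
      ∑ i, fderiv ℝ (fun q => η q.1 * ψ q.2 ^ 2 * (fderiv ℝ w q (1, 0) *
          fderiv ℝ w q (0, EuclideanSpace.single i 1))) p (0, EuclideanSpace.single i 1)
      - fderiv ℝ (fun q => η q.1 * ψ q.2 ^ 2 *
          ∑ i, fderiv ℝ w q (0, EuclideanSpace.single i 1) ^ 2) p (1, 0) / 2
      - 2 * η p.1 * ψ p.2 * fderiv ℝ w p (1, 0) *
          ∑ i, fderiv ℝ ψ p.2 (EuclideanSpace.single i 1) *
            fderiv ℝ w p (0, EuclideanSpace.single i 1)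
      + deriv η p.1 * ψ p.2 ^ 2 * (∑ i, fderiv ℝ w p (0, EuclideanSpace.single i 1) ^ 2) / 2 := by
  have hD : ∀ e, DifferentiableAt ℝ (fun q => fderiv ℝ w q e) p := fun e =>
    (contDiff_fderiv_apply hw e).differentiable (by simp) p
  have hφ : DifferentiableAt ℝ
      (fun q : ℝ × EuclideanSpace ℝ (Fin d) => η q.1 * ψ q.2 ^ 2) p :=
    ContDiff.differentiable (n := 1) (by fun_prop) one_ne_zero p
  have hG : ∀ i : Fin d, fderiv ℝ (fun q => η q.1 * ψ q.2 ^ 2 * (fderiv ℝ w q (1, 0) *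
      fderiv ℝ w q (0, EuclideanSpace.single i 1))) p (0, EuclideanSpace.single i 1)
      = 2 * η p.1 * ψ p.2 * fderiv ℝ w p (1, 0) * (fderiv ℝ ψ p.2 (EuclideanSpace.single i 1) *
          fderiv ℝ w p (0, EuclideanSpace.single i 1))
        + η p.1 * ψ p.2 ^ 2 * (fderiv ℝ w p (0, EuclideanSpace.single i 1) * fderiv ℝ
          (fun q => fderiv ℝ w q (0, EuclideanSpace.single i 1)) p (1, 0))
        + η p.1 * ψ p.2 ^ 2 * fderiv ℝ w p (1, 0) * fderiv ℝ
          (fun q => fderiv ℝ w q (0, EuclideanSpace.single i 1)) p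
            (0, EuclideanSpace.single i 1) := fun i => by
    rw [fderiv_fun_mul hφ ((hD _).fun_mul (hD _)), fderiv_fun_mul (hD _) (hD _)]
    simp only [add_apply, smul_apply, smul_eq_mul,
      fderiv_cutoff_snd hη hψ]
    rw [fderiv_fderiv_apply_comm hw p (1, 0)]
    ring
  have hH : fderiv ℝ (fun q => η q.1 * ψ q.2 ^ 2 *
      ∑ i, fderiv ℝ w q (0, EuclideanSpace.single i 1) ^ 2) p (1, 0)
      = deriv η p.1 * ψ p.2 ^ 2 * (∑ i, fderiv ℝ w p (0, EuclideanSpace.single i 1) ^ 2)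
        + 2 * (η p.1 * ψ p.2 ^ 2 * ∑ i, fderiv ℝ w p (0, EuclideanSpace.single i 1) * fderiv ℝ
          (fun q => fderiv ℝ w q (0, EuclideanSpace.single i 1)) p (1, 0)) := by
    rw [fderiv_fun_mul hφ (DifferentiableAt.fun_sum fun i _ => (hD _).fun_pow 2),
      fderiv_fun_sum fun i _ => (hD _).fun_pow 2]
    simp only [add_apply, smul_apply, smul_eq_mul,
      fderiv_cutoff_fst hη hψ, _root_.sum_apply]
    simp only [fderiv_fun_pow 2 (hD _), smul_apply, smul_eq_mul,
      Finset.mul_sum]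
    rw [Finset.sum_mul, ← Finset.sum_add_distrib, ← Finset.sum_add_distrib]
    refine Finset.sum_congr rfl fun i _ => ?_
    simp
    ring
  rw [hH]
  simp only [hG, Finset.sum_add_distrib, ← Finset.mul_sum]
  rw [← heat]
  ring

lemma cutoff_mul_timeDeriv_sq_le (hw : ContDiff ℝ (⊤ : ℕ∞) w) (hη : ContDiff ℝ 1 η)
    (hψ : ContDiff ℝ 1 ψ) (p : ℝ × EuclideanSpace ℝ (Fin d)) {L M : ℝ}
    (hη0 : 0 ≤ η p.1) (hη1 : η p.1 ≤ 1) (hηL : deriv η p.1 ≤ L) (hL : 0 ≤ L)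
    (hψ1 : ψ p.2 ^ 2 ≤ 1) (hψM : ∑ i, fderiv ℝ ψ p.2 (EuclideanSpace.single i 1) ^ 2 ≤ M)
    (heat : fderiv ℝ w p (1, 0) = ∑ i, fderiv ℝ
      (fun q => fderiv ℝ w q (0, EuclideanSpace.single i 1)) p (0, EuclideanSpace.single i 1)) :
    η p.1 * ψ p.2 ^ 2 * fderiv ℝ w p (1, 0) ^ 2 ≤
      2 * (∑ i, fderiv ℝ (fun q => η q.1 * ψ q.2 ^ 2 * (fderiv ℝ w q (1, 0) *
          fderiv ℝ w q (0, EuclideanSpace.single i 1))) p (0, EuclideanSpace.single i 1))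
      - fderiv ℝ (fun q => η q.1 * ψ q.2 ^ 2 *
          ∑ i, fderiv ℝ w q (0, EuclideanSpace.single i 1) ^ 2) p (1, 0)
      + (L + 4 * M) * ∑ i, fderiv ℝ w p (0, EuclideanSpace.single i 1) ^ 2 := by
  have key := cutoff_mul_timeDeriv_sq_eq hw hη hψ p heat
  have cs := Finset.sum_mul_sq_le_sq_mul_sq Finset.univ
    (fun i => fderiv ℝ ψ p.2 (EuclideanSpace.single i 1))
    (fun i => fderiv ℝ w p (0, EuclideanSpace.single i 1))
  have hB : 0 ≤ ∑ i, fderiv ℝ w p (0, EuclideanSpace.single i 1) ^ 2 :=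
    Finset.sum_nonneg fun i _ => sq_nonneg _
  have hP : 0 ≤ ∑ i, fderiv ℝ ψ p.2 (EuclideanSpace.single i 1) ^ 2 :=
    Finset.sum_nonneg fun i _ => sq_nonneg _
  generalize (∑ i, fderiv ℝ w p (0, EuclideanSpace.single i 1) ^ 2) = B at *
  generalize (∑ i, fderiv ℝ ψ p.2 (EuclideanSpace.single i 1) ^ 2) = P at *
  generalize (∑ i, fderiv ℝ ψ p.2 (EuclideanSpace.single i 1) *
    fderiv ℝ w p (0, EuclideanSpace.single i 1)) = S at *
  generalize fderiv ℝ w p (1, 0) = a at *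
  have hyoung : -(2 * η p.1 * ψ p.2 * a * S) ≤ η p.1 * ψ p.2 ^ 2 * a ^ 2 / 2 + 2 * (η p.1 * S ^ 2) := by
    nlinarith [mul_nonneg hη0 (sq_nonneg (ψ p.2 * a + 2 * S))]
  have hS : η p.1 * S ^ 2 ≤ M * B :=
    calc η p.1 * S ^ 2 ≤ 1 * S ^ 2 := by gcongr
      _ ≤ M * B := by rw [one_mul]; exact cs.trans (by gcongr)
  have ht : deriv η p.1 * ψ p.2 ^ 2 * B ≤ L * B := by
    refine mul_le_mul_of_nonneg_right ?_ hB
    calc deriv η p.1 * ψ p.2 ^ 2 ≤ L * ψ p.2 ^ 2 := by gcongr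
      _ ≤ L * 1 := by gcongr
      _ = L := mul_one L
  linarith

/-- Weighted Caccioppoli inequality for the time derivative. -/
lemma setIntegral_cutoff_mul_timeDeriv_sq_le (hw : ContDiff ℝ (⊤ : ℕ∞) w) (hη : ContDiff ℝ 1 η)
    (hψ : ContDiff ℝ 1 ψ) {x₀ : EuclideanSpace ℝ (Fin d)} {a b R L M : ℝ} (hab : a ≤ b)
    (hηa : η a = 0) (hη0 : ∀ t ∈ Icc a b, 0 ≤ η t) (hη1 : ∀ t ∈ Icc a b, η t ≤ 1)
    (hηL : ∀ t ∈ Icc a b, deriv η t ≤ L) (hL : 0 ≤ L)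
    (hψ0 : ∀ x, x ∉ Metric.closedBall x₀ R → ψ x = 0) (hψ1 : ∀ x, ψ x ^ 2 ≤ 1)
    (hψM : ∀ x ∈ Metric.closedBall x₀ R,
      ∑ i, fderiv ℝ ψ x (EuclideanSpace.single i 1) ^ 2 ≤ M)
    (heat : ∀ p ∈ Icc a b ×ˢ Metric.closedBall x₀ R, fderiv ℝ w p (1, 0) = ∑ i, fderiv ℝ
      (fun q => fderiv ℝ w q (0, EuclideanSpace.single i 1)) p (0, EuclideanSpace.single i 1)) :
    ∫ p in Icc a b ×ˢ Metric.closedBall x₀ R, η p.1 * ψ p.2 ^ 2 * fderiv ℝ w p (1, 0) ^ 2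
      ≤ (L + 4 * M) * ∫ p in Icc a b ×ˢ Metric.closedBall x₀ R,
          ∑ i, fderiv ℝ w p (0, EuclideanSpace.single i 1) ^ 2 := by
  set Q := Icc a b ×ˢ Metric.closedBall x₀ R
  have hD : ∀ e, ContDiff ℝ 1 fun q => fderiv ℝ w q e := fun e =>
    (contDiff_fderiv_apply hw e).of_le (by exact_mod_cast le_top)
  have hφ : ContDiff ℝ 1 (fun q : ℝ × EuclideanSpace ℝ (Fin d) => η q.1 * ψ q.2 ^ 2) := by
    fun_prop
  have hG : ∀ i : Fin d, ContDiff ℝ 1 fun q => η q.1 * ψ q.2 ^ 2 * (fderiv ℝ w q (1, 0) *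
      fderiv ℝ w q (0, EuclideanSpace.single i 1)) := fun i =>
    hφ.mul ((hD _).mul (hD _))
  have hB : ContDiff ℝ 1 fun q => ∑ i, fderiv ℝ w q (0, EuclideanSpace.single i 1) ^ 2 :=
    ContDiff.sum fun i _ => (hD _).pow 2
  have hH : ContDiff ℝ 1 fun q => η q.1 * ψ q.2 ^ 2 *
      ∑ i, fderiv ℝ w q (0, EuclideanSpace.single i 1) ^ 2 := hφ.mul hB
  have hint : ∀ {F : ℝ × EuclideanSpace ℝ (Fin d) → ℝ}, Continuous F →
      IntegrableOn F Q := fun hF => integrableOn_Icc_prod_closedBall hF a b x₀ R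
  have hQ : MeasurableSet Q := measurableSet_Icc.prod measurableSet_closedBall
  have iL := hint (hφ.continuous.mul ((hD (1, 0)).continuous.pow 2))
  have iG := fun i => hint (((hG i).continuous_fderiv one_ne_zero).clm_apply
    (continuous_const (y := (0, EuclideanSpace.single i 1))))
  have iGs := (integrable_finsetSum Finset.univ fun i _ => iG i).const_mul 2
  have iH := hint ((hH.continuous_fderiv one_ne_zero).clm_apply
    (continuous_const (y := (1, 0))))
  have iB := (hint hB.continuous).const_mul (L + 4 * M)
  have zG : ∀ i : Fin d, ∫ p in Q, fderiv ℝ (fun q => η q.1 * ψ q.2 ^ 2 * (fderiv ℝ w q (1, 0) *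
      fderiv ℝ w q (0, EuclideanSpace.single i 1))) p (0, EuclideanSpace.single i 1) = 0 :=
    fun i => setIntegral_fderiv_snd_eq_zero (hG i)
      (fun t x hx => by simp [hψ0 x hx]) a b (EuclideanSpace.single i 1)
  have zH : 0 ≤ ∫ p in Q, fderiv ℝ (fun q => η q.1 * ψ q.2 ^ 2 *
      ∑ i, fderiv ℝ w q (0, EuclideanSpace.single i 1) ^ 2) p (1, 0) := by
    refine le_of_le_of_eq (integral_nonneg fun x => ?_)
      (setIntegral_fderiv_fst (μ := volume) hH x₀ R hab).symm
    have := hη0 b (right_mem_Icc.2 hab)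
    simp only [hηa, zero_mul, sub_zero, Pi.zero_apply]
    positivity
  calc _ ≤ ∫ p in Q, (2 * (∑ i, fderiv ℝ (fun q => η q.1 * ψ q.2 ^ 2 * (fderiv ℝ w q (1, 0) *
          fderiv ℝ w q (0, EuclideanSpace.single i 1))) p (0, EuclideanSpace.single i 1))
      - fderiv ℝ (fun q => η q.1 * ψ q.2 ^ 2 *
          ∑ i, fderiv ℝ w q (0, EuclideanSpace.single i 1) ^ 2) p (1, 0)
      + (L + 4 * M) * ∑ i, fderiv ℝ w p (0, EuclideanSpace.single i 1) ^ 2) :=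
        setIntegral_mono_on iL ((iGs.sub iH).add iB) hQ fun p hp =>
          cutoff_mul_timeDeriv_sq_le hw hη hψ p (hη0 _ hp.1) (hη1 _ hp.1) (hηL _ hp.1) hL
            (hψ1 _) (hψM _ hp.2) (heat p hp)
    _ ≤ _ := by
      rw [integral_add (iGs.sub' iH) iB, integral_sub iGs iH, integral_const_mul,
        integral_const_mul, integral_finsetSum _ fun i _ => iG i]
      simp only [zG, Finset.sum_const_zero]
      linarith

end Energy

/-- Existence of a spatial cutoff between concentric balls. -/
lemma exists_spatial_cutoff {d : ℕ} (x₀ : EuclideanSpace ℝ (Fin d)) {r R M : ℝ}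
    (hrR : r ^ 2 < R ^ 2) (hR : 0 ≤ R) (hr : 0 ≤ r)
    (hM : ∀ s, |deriv Real.smoothTransition s| ≤ M) :
    ∃ ψ : EuclideanSpace ℝ (Fin d) → ℝ, ContDiff ℝ 1 ψ ∧
      (∀ x, x ∉ Metric.closedBall x₀ R → ψ x = 0) ∧ (∀ x, ψ x ^ 2 ≤ 1) ∧
      (∀ x, ‖x - x₀‖ < r → ψ x = 1) ∧
      ∀ x ∈ Metric.closedBall x₀ R, ∑ i, fderiv ℝ ψ x (EuclideanSpace.single i 1) ^ 2
        ≤ (2 * M * R / (R ^ 2 - r ^ 2)) ^ 2 := by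
  have hδ : 0 < R ^ 2 - r ^ 2 := sub_pos.2 hrR
  refine ⟨fun x => Real.smoothTransition ((R ^ 2 - ‖x - x₀‖ ^ 2) / (R ^ 2 - r ^ 2)),
    ?_, fun x hx => ?_, fun x => ?_, fun x hx => ?_, fun x hx => ?_⟩
  · refine Real.smoothTransition.contDiff.comp ?_
    exact (contDiff_const.sub ((contDiff_id.sub contDiff_const).norm_sq ℝ)).div_const _
  · refine Real.smoothTransition.zero_of_nonpos (div_nonpos_of_nonpos_of_nonneg ?_ hδ.le)
    rw [Metric.mem_closedBall, dist_eq_norm, not_le] at hx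
    nlinarith
  · exact pow_le_one₀ (Real.smoothTransition.nonneg _) (Real.smoothTransition.le_one _)
  · refine Real.smoothTransition.one_of_one_le ((one_le_div hδ).2 ?_)
    nlinarith [norm_nonneg (x - x₀)]
  · rw [Metric.mem_closedBall, dist_eq_norm] at hx
    have hn : HasFDerivAt (fun y => (R ^ 2 - ‖y - x₀‖ ^ 2) / (R ^ 2 - r ^ 2))
        ((R ^ 2 - r ^ 2)⁻¹ • -((2 : ℕ) • (innerSL ℝ (x - x₀)))) x := by
      have h := ((hasFDerivAt_id x).sub_const x₀).norm_sq
      have h' := (h.const_sub (R ^ 2)).mul_const (R ^ 2 - r ^ 2)⁻¹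
      simpa [div_eq_mul_inv] using h'
    have hS := (Real.smoothTransition.contDiff (n := 1)).differentiable one_ne_zero
      ((R ^ 2 - ‖x - x₀‖ ^ 2) / (R ^ 2 - r ^ 2))
    have hf := (hS.hasDerivAt.comp_hasFDerivAt x hn).fderiv
    simp only [Function.comp_def] at hf
    have hterm : ∀ i : Fin d, fderiv ℝ (fun y => Real.smoothTransition
        ((R ^ 2 - ‖y - x₀‖ ^ 2) / (R ^ 2 - r ^ 2))) x (EuclideanSpace.single i 1) ^ 2
        = (2 * deriv Real.smoothTransition ((R ^ 2 - ‖x - x₀‖ ^ 2) / (R ^ 2 - r ^ 2))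
          / (R ^ 2 - r ^ 2)) ^ 2 * ((x - x₀) i) ^ 2 := fun i => by
      rw [hf]
      simp [EuclideanSpace.inner_single_right]
      ring
    simp only [hterm]
    rw [← Finset.mul_sum, ← EuclideanSpace.real_norm_sq_eq, ← mul_pow, sq_le_sq]
    refine le_trans ?_ (le_abs_self _)
    have := hM ((R ^ 2 - ‖x - x₀‖ ^ 2) / (R ^ 2 - r ^ 2))
    rw [abs_mul, abs_div, abs_mul, abs_two, abs_of_pos hδ, abs_norm, div_mul_eq_mul_div]
    have hM0 : 0 ≤ M := (abs_nonneg _).trans this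
    gcongr

lemma exists_temporal_cutoff {k a b c : ℝ} (hk : 0 < k) (hab : k * a + 1 / 2 = k * c) :
    ∃ η : ℝ → ℝ, ContDiff ℝ 1 η ∧ η a = 0 ∧ (∀ t ∈ Icc a b, 0 ≤ η t) ∧
      (∀ t ∈ Icc a b, η t ≤ 1) ∧ (∀ t ∈ Icc a b, deriv η t ≤ k) ∧ ∀ t, c ≤ t → 1 / 3 ≤ η t := by
  refine ⟨fun t => 1 - Real.exp (-(k * (t - a))), by fun_prop, by simp, fun t ht => ?_,
    fun t _ => by linarith [Real.exp_pos (-(k * (t - a)))], fun t ht => ?_, fun t ht => ?_⟩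
  · have := mul_nonneg hk.le (sub_nonneg.2 ht.1)
    simpa using this
  · have h : HasDerivAt (fun t => 1 - Real.exp (-(k * (t - a))))
        (k * Real.exp (-(k * (t - a)))) t := by
      have h1 := ((((hasDerivAt_id t).sub_const a).const_mul k).neg.exp).const_sub 1
      refine h1.congr_deriv ?_
      simp
      ring
    rw [h.deriv]
    refine mul_le_of_le_one_right hk.le (Real.exp_le_one_iff.2 ?_)
    have := mul_nonneg hk.le (sub_nonneg.2 ht.1)
    linarith
  · have h1 : (1 : ℝ) / 2 ≤ k * (t - a) := by nlinarith
    have h2 : (3 : ℝ) / 2 ≤ Real.exp (k * (t - a)) := by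
      linarith [Real.add_one_le_exp (k * (t - a))]
    have h3 : Real.exp (-(k * (t - a))) ≤ 2 / 3 := by
      rw [Real.exp_neg]
      calc (Real.exp (k * (t - a)))⁻¹ ≤ (3 / 2 : ℝ)⁻¹ := by gcongr
        _ = 2 / 3 := by norm_num
    linarith

section Extension

variable {d : ℕ} {w : ℝ × EuclideanSpace ℝ (Fin d) → ℝ} {u : ℝ → EuclideanSpace ℝ (Fin d) → ℝ}
  {p : ℝ × EuclideanSpace ℝ (Fin d)}

lemma deriv_time_eq_of_eventuallyEq (hw : DifferentiableAt ℝ w p)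
    (h : w =ᶠ[nhds p] fun q => u q.1 q.2) :
    deriv (fun s => u s p.2) p.1 = fderiv ℝ w p (1, 0) := by
  have hc : Filter.Tendsto (fun s : ℝ => (s, p.2)) (nhds p.1) (nhds p) :=
    Continuous.tendsto (by fun_prop) _
  exact ((hasDerivAt_slice_fst hw).congr_of_eventuallyEq (Filter.EventuallyEq.symm (hc.eventually h))).deriv

lemma fderiv_space_eq_of_eventuallyEq (hw : DifferentiableAt ℝ w p)
    (h : w =ᶠ[nhds p] fun q => u q.1 q.2) (e : EuclideanSpace ℝ (Fin d)) :
    fderiv ℝ (u p.1) p.2 e = fderiv ℝ w p (0, e) := by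
  have hc : Filter.Tendsto (fun y => (p.1, y)) (nhds p.2) (nhds p) :=
    Continuous.tendsto (by fun_prop) _
  have h' : (fun y => w (p.1, y)) =ᶠ[nhds p.2] u p.1 := hc.eventually h
  rw [← h'.fderiv_eq, fderiv_slice_snd hw]

lemma norm_gradient_sq_eq_sum (f : EuclideanSpace ℝ (Fin d) → ℝ) (x : EuclideanSpace ℝ (Fin d)) :
    ‖gradient f x‖ ^ 2 = ∑ i, fderiv ℝ f x (EuclideanSpace.single i 1) ^ 2 := by
  rw [EuclideanSpace.real_norm_sq_eq]
  refine Finset.sum_congr rfl fun i _ => ?_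
  rw [← toDual_gradient, InnerProductSpace.toDual_apply_apply, EuclideanSpace.inner_single_right]
  simp

lemma lap_eq_of_eventuallyEq (hw : ContDiff ℝ (⊤ : ℕ∞) w)
    (h : w =ᶠ[nhds p] fun q => u q.1 q.2) :
    Lap (u p.1) p.2 = ∑ i, fderiv ℝ (fun q => fderiv ℝ w q (0, EuclideanSpace.single i 1)) p
      (0, EuclideanSpace.single i 1) := by
  refine Finset.sum_congr rfl fun i _ => ?_
  refine fderiv_space_eq_of_eventuallyEq
    (u := fun t y => fderiv ℝ (u t) y (EuclideanSpace.single i 1))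
    ((contDiff_fderiv_apply hw _).differentiable (by simp) p) ?_ _
  filter_upwards [h.eventually_nhds] with q hq
  exact (fderiv_space_eq_of_eventuallyEq (hw.differentiable (by simp) q) hq _).symm

end Extension

/-- For a smooth solution of the heat equation on (a neighborhood of) `[-1,0] × ℝ^d`, with
`Ω¹_j = {(t,x) : |x-x₀| < j/√k, t ∈ [-j/k,0]}` and
`Ω²_j = {(t,x) : |x-x₀| < (j+0.5)/√k, t ∈ [-(j+0.5)/k,0]}`, one has
`∫_{Ω¹_j} (∂ₜu)² ≤ C k ∫_{Ω²_j} |∇u|²`, where `C` depends only on `d`. -/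
theorem caccioppoli_time_derivative (d : ℕ) :
    ∃ C > (0:ℝ),
      ∀ (u : ℝ → EuclideanSpace ℝ (Fin d) → ℝ),
      ∀ U : Set (ℝ × EuclideanSpace ℝ (Fin d)), IsOpen U →
        (Set.Icc (-1:ℝ) 0 ×ˢ (Set.univ : Set (EuclideanSpace ℝ (Fin d)))) ⊆ U →
        ContDiffOn ℝ (⊤ : ℕ∞) (fun p : ℝ × EuclideanSpace ℝ (Fin d) => u p.1 p.2) U →
        (∀ p ∈ U, deriv (fun s => u s p.2) p.1 = Lap (u p.1) p.2) →
        ∀ (x₀ : EuclideanSpace ℝ (Fin d)) (k j : ℕ), 1 ≤ k → 1 ≤ j → j + 1 ≤ k →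
        (∫ p in {p : ℝ × EuclideanSpace ℝ (Fin d) |
            ‖p.2 - x₀‖ < (j:ℝ) / Real.sqrt k ∧ p.1 ∈ Set.Icc (-(j:ℝ)/k) 0},
          (deriv (fun s => u s p.2) p.1)^2 ∂volume)
        ≤ C * k * ∫ p in {p : ℝ × EuclideanSpace ℝ (Fin d) |
            ‖p.2 - x₀‖ < ((j:ℝ) + 0.5) / Real.sqrt k ∧ p.1 ∈ Set.Icc (-((j:ℝ)+0.5)/k) 0},
          ‖gradient (u p.1) p.2‖^2 ∂volume := by
  obtain ⟨M, hM0, hM⟩ := exists_abs_deriv_smoothTransition_le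
  refine ⟨3 * (1 + 4 * (64 * M ^ 2)), by positivity, ?_⟩
  intro u U hU hKU hu heat x₀ k j hk hj hjk
  obtain ⟨w, hw, hwu⟩ := exists_contDiff_eventuallyEq_nhdsSet hU (isClosed_Icc.prod isClosed_univ)
    hKU hu
  have hk0 : (0 : ℝ) < k := by exact_mod_cast hk
  have hj1 : (1 : ℝ) ≤ j := by exact_mod_cast hj
  have hjk' : (j : ℝ) + 1 ≤ k := by exact_mod_cast hjk
  have hsk : 0 < √(k : ℝ) := Real.sqrt_pos.2 hk0
  have hsq : √(k : ℝ) ^ 2 = k := Real.sq_sqrt hk0.le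
  set T : ℝ := -((j : ℝ) + 0.5) / k with hT
  set r : ℝ := (j : ℝ) / √k with hr
  set R : ℝ := ((j : ℝ) + 1 / 4) / √k with hR
  have hT1 : -1 ≤ T := by rw [hT, le_div_iff₀ hk0]; linarith
  have hTj : T ≤ -(j : ℝ) / k := by rw [hT]; gcongr; linarith
  have hT0 : T ≤ 0 := hTj.trans (by rw [neg_div]; exact neg_nonpos.2 (by positivity))
  have hr0 : 0 ≤ r := by positivity
  have hR0 : 0 ≤ R := by positivity
  have hrR : r < R := by rw [hr, hR]; gcongr; linarith
  have hRk : (2 * M * R / (R ^ 2 - r ^ 2)) ^ 2 ≤ 64 * M ^ 2 * k := by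
    have e : 2 * M * R / (R ^ 2 - r ^ 2)
        = 2 * M * √k * ((j + 1 / 4) / ((j + 1 / 4) ^ 2 - j ^ 2)) := by
      rw [hR, hr]
      have : ((j : ℝ) + 1 / 4) ^ 2 - j ^ 2 ≠ 0 := by nlinarith
      have h2 : (((j : ℝ) + 1 / 4) / √k) ^ 2 - (j / √k) ^ 2 ≠ 0 := by
        rw [div_pow, div_pow, ← sub_div]; positivity
      field_simp
    have hq : ((j : ℝ) + 1 / 4) / ((j + 1 / 4) ^ 2 - j ^ 2) ≤ 4 := by
      rw [div_le_iff₀ (by nlinarith)]; nlinarith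
    have hq0 : 0 ≤ ((j : ℝ) + 1 / 4) / ((j + 1 / 4) ^ 2 - j ^ 2) :=
      div_nonneg (by positivity) (by nlinarith)
    calc (2 * M * R / (R ^ 2 - r ^ 2)) ^ 2 ≤ (2 * M * √k * 4) ^ 2 := by rw [e]; gcongr
      _ = 64 * M ^ 2 * √(k : ℝ) ^ 2 := by ring
      _ = 64 * M ^ 2 * k := by rw [hsq]
  obtain ⟨ψ, hψ, hψ0, hψ1, hψr, hψM⟩ := exists_spatial_cutoff x₀
    (pow_lt_pow_left₀ hrR hr0 two_ne_zero) hR0 hr0 hM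
  obtain ⟨η, hη, hηT, hη0, hη1, hηk, hηj⟩ := exists_temporal_cutoff (k := k) (a := T) (b := 0)
    (c := -(j : ℝ) / k) hk0 (by rw [hT]; field_simp; norm_num; ring)
  have hmem : ∀ p : ℝ × EuclideanSpace ℝ (Fin d), p.1 ∈ Icc T 0 →
      p ∈ Icc (-1 : ℝ) 0 ×ˢ (univ : Set (EuclideanSpace ℝ (Fin d))) :=
    fun p hp => ⟨⟨hT1.trans hp.1, hp.2⟩, mem_univ _⟩
  have hwd : Differentiable ℝ w := hw.differentiable (by simp)
  have energy := setIntegral_cutoff_mul_timeDeriv_sq_le hw hη hψ hT0 hηT hη0 hη1 hηk hk0.le hψ0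
    hψ1 (fun x hx => (hψM x hx).trans hRk) fun p hp => by
      have hp' := hwu p (hmem p hp.1)
      rw [← deriv_time_eq_of_eventuallyEq (hwd p) hp', heat p (hKU (hmem p hp.1)),
        lap_eq_of_eventuallyEq hw hp']
  have hΩ : ∀ ρ a : ℝ, {p : ℝ × EuclideanSpace ℝ (Fin d) | ‖p.2 - x₀‖ < ρ ∧ p.1 ∈ Icc a 0}
      = Icc a 0 ×ˢ Metric.ball x₀ ρ := fun ρ a => by
    ext p; simp [dist_eq_norm, and_comm]
  have hΩm : ∀ ρ a : ℝ, MeasurableSet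
      (Icc a 0 ×ˢ Metric.ball x₀ ρ : Set (ℝ × EuclideanSpace ℝ (Fin d))) := fun ρ a =>
    measurableSet_Icc.prod measurableSet_ball
  have hDc : ∀ e, Continuous fun q => fderiv ℝ w q e := fun e =>
    (contDiff_fderiv_apply hw e).continuous
  have hint : ∀ {F : ℝ × EuclideanSpace ℝ (Fin d) → ℝ}, Continuous F → ∀ ρ,
      IntegrableOn F (Icc T 0 ×ˢ Metric.closedBall x₀ ρ) := fun hF ρ =>
    integrableOn_Icc_prod_closedBall hF T 0 x₀ ρ
  have hφc : Continuous fun p : ℝ × EuclideanSpace ℝ (Fin d) =>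
      η p.1 * ψ p.2 ^ 2 * fderiv ℝ w p (1, 0) ^ 2 := by
    have := hDc (1, 0)
    have := hη.continuous
    have := hψ.continuous
    fun_prop
  have hBc : Continuous fun p : ℝ × EuclideanSpace ℝ (Fin d) =>
      ∑ i, fderiv ℝ w p (0, EuclideanSpace.single i 1) ^ 2 :=
    continuous_finsetSum _ fun i _ => (hDc _).pow 2
  have hsub : (Icc (-(j : ℝ) / k) 0 ×ˢ Metric.ball x₀ r : Set (ℝ × EuclideanSpace ℝ (Fin d)))
      ⊆ Icc T 0 ×ˢ Metric.closedBall x₀ R :=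
    prod_mono (Icc_subset_Icc_left hTj)
      (Metric.ball_subset_closedBall.trans (Metric.closedBall_subset_closedBall hrR.le))
  have hsub' : (Icc T 0 ×ˢ Metric.closedBall x₀ R : Set (ℝ × EuclideanSpace ℝ (Fin d)))
      ⊆ Icc T 0 ×ˢ Metric.ball x₀ (((j : ℝ) + 0.5) / √k) := by
    refine prod_mono_right (Metric.closedBall_subset_ball ?_)
    rw [hR]; gcongr; norm_num
  rw [hΩ, hΩ]
  have left : ∫ p in Icc (-(j : ℝ) / k) 0 ×ˢ Metric.ball x₀ r, deriv (fun s => u s p.2) p.1 ^ 2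
      ≤ 3 * ∫ p in Icc T 0 ×ˢ Metric.closedBall x₀ R,
        η p.1 * ψ p.2 ^ 2 * fderiv ℝ w p (1, 0) ^ 2 := by
    rw [← integral_const_mul]
    calc _ = ∫ p in Icc (-(j : ℝ) / k) 0 ×ˢ Metric.ball x₀ r, fderiv ℝ w p (1, 0) ^ 2 :=
          setIntegral_congr_fun (hΩm _ _) fun p hp => by
            rw [deriv_time_eq_of_eventuallyEq (hwd p) (hwu p (hmem p (hsub hp).1))]
      _ ≤ ∫ p in Icc (-(j : ℝ) / k) 0 ×ˢ Metric.ball x₀ r,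
            3 * (η p.1 * ψ p.2 ^ 2 * fderiv ℝ w p (1, 0) ^ 2) := by
          refine setIntegral_mono_on ((hint ((hDc (1, 0)).pow 2) R).mono_set hsub)
            (((hint hφc R).mono_set hsub).const_mul 3) (hΩm _ _) fun p hp => ?_
          rw [hψr p.2 (by simpa [dist_eq_norm] using hp.2)]
          nlinarith [hηj p.1 hp.1.1, sq_nonneg (fderiv ℝ w p (1, 0))]
      _ ≤ _ := by
          refine setIntegral_mono_set ((hint hφc R).const_mul 3) ?_ hsub.eventuallyLE
          refine (ae_restrict_iff' (measurableSet_Icc.prod measurableSet_closedBall)).2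
            (Filter.Eventually.of_forall fun p hp => ?_)
          have := hη0 p.1 hp.1
          simp only [Pi.zero_apply]
          positivity
  have right : ∫ p in Icc T 0 ×ˢ Metric.closedBall x₀ R,
        ∑ i, fderiv ℝ w p (0, EuclideanSpace.single i 1) ^ 2
      ≤ ∫ p in Icc T 0 ×ˢ Metric.ball x₀ (((j : ℝ) + 0.5) / √k), ‖gradient (u p.1) p.2‖ ^ 2 := by
    calc _ ≤ ∫ p in Icc T 0 ×ˢ Metric.ball x₀ (((j : ℝ) + 0.5) / √k),
          ∑ i, fderiv ℝ w p (0, EuclideanSpace.single i 1) ^ 2 :=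
          setIntegral_mono_set ((hint hBc _).mono_set (prod_mono_right Metric.ball_subset_closedBall))
            (Filter.Eventually.of_forall fun p => Finset.sum_nonneg fun i _ => sq_nonneg _)
            hsub'.eventuallyLE
      _ = _ := setIntegral_congr_fun (hΩm _ _) fun p hp => by
          rw [norm_gradient_sq_eq_sum]
          simp only [fderiv_space_eq_of_eventuallyEq (hwd p) (hwu p (hmem p hp.1))]
  calc _ ≤ _ := left
    _ ≤ 3 * ((k + 4 * (64 * M ^ 2 * k)) * _) := mul_le_mul_of_nonneg_left energy (by norm_num)
    _ ≤ 3 * ((k + 4 * (64 * M ^ 2 * k)) * _) :=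
        mul_le_mul_of_nonneg_left (mul_le_mul_of_nonneg_left right (by positivity)) (by norm_num)
    _ = _ := by ring
end

section
/- There exists a constant C > 0 depending only on d with the following property. Let u be a smooth solution of the heat equation ∂_t u = Δu on [−1,0] × ℝ^d, let x₀ ∈ ℝ^d, let k ≥ 1 be an integer, and let 1 ≤ j ≤ k − 1 be an integer. Set Ω²_j = {(t,x) : |x − x₀| < (j+0.5)/√k, t ∈ [−(j+0.5)/k, 0]} and Ω¹_{j+1} = {(t,x) : |x − x₀| < (j+1)/√k, t ∈ [−(j+1)/k, 0]}. Then ∫_{Ω²_j} |∇u|² dx dt ≤ C k ∫_{Ω¹_{j+1}} u² dx dt. -/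
open Real Set MeasureTheory

/-- The integral of a directional derivative of a compactly supported `C¹` function vanishes. -/
theorem integral_fderiv_apply_eq_zero {E : Type*} [NormedAddCommGroup E] [NormedSpace ℝ E]
    [FiniteDimensional ℝ E] [MeasurableSpace E] [BorelSpace E] (μ : Measure E)
    [μ.IsAddHaarMeasure] {f : E → ℝ} (hf : ContDiff ℝ 1 f) (hc : HasCompactSupport f) (v : E) :
    ∫ x, fderiv ℝ f x v ∂μ = 0 := by
  have hd : Continuous fun x => fderiv ℝ f x v :=
    (hf.continuous_fderiv one_ne_zero).clm_apply continuous_const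
  have hd' : Integrable (fun x => fderiv ℝ f x v) μ :=
    hd.integrable_of_hasCompactSupport (hc.fderiv_apply (𝕜 := ℝ) v)
  have h := integral_mul_fderiv_eq_neg_fderiv_mul_of_integrable (μ := μ) (f := fun _ : E => (1 : ℝ))
    (g := f) (v := v) (by simp) (by simpa using hd')
    (by simpa using hf.continuous.integrable_of_hasCompactSupport hc)
    (fun x _ => differentiableAt_const _) (fun x _ => hf.differentiable one_ne_zero x)
  simpa using h

theorem hasFDerivAt_slice_right {E F : Type*} [NormedAddCommGroup E] [NormedSpace ℝ E]
    [NormedAddCommGroup F] [NormedSpace ℝ F] {V : F × E → ℝ} {t : F} {x : E}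
    (h : DifferentiableAt ℝ V (t, x)) :
    HasFDerivAt (fun y => V (t, y))
      ((fderiv ℝ V (t, x)).comp (ContinuousLinearMap.inr ℝ F E)) x :=
  h.hasFDerivAt.comp x (hasFDerivAt_prodMk_right t x)

theorem hasDerivAt_slice_left {E : Type*} [NormedAddCommGroup E] [NormedSpace ℝ E]
    {V : ℝ × E → ℝ} {t : ℝ} {x : E} (h : DifferentiableAt ℝ V (t, x)) :
    HasDerivAt (fun s => V (s, x)) (fderiv ℝ V (t, x) (1, 0)) t := by
  have := (h.hasFDerivAt.comp t (hasFDerivAt_prodMk_left t x)).hasDerivAt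
  simpa [Function.comp_def] using this

/-- A continuous function on space-time that is compactly supported in space is integrable over
compact time intervals. -/
theorem Continuous.integrable_Icc_prod {E : Type*} [NormedAddCommGroup E] [MeasurableSpace E]
    [BorelSpace E] [SecondCountableTopology E] (μ : Measure E) [IsFiniteMeasureOnCompacts μ]
    [SFinite μ] {F : ℝ × E → ℝ} (hF : Continuous F) {K : Set E} (hK : IsCompact K)
    (h0 : ∀ t, ∀ x ∉ K, F (t, x) = 0) (a b : ℝ) :
    Integrable F ((volume.restrict (Icc a b)).prod μ) := by
  have h1 : IntegrableOn F (Icc a b ×ˢ K) (volume.prod μ) :=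
    hF.continuousOn.integrableOn_compact (isCompact_Icc.prod hK)
  rw [IntegrableOn, ← Measure.prod_restrict] at h1
  have h2 : (volume.restrict (Icc a b)).prod (μ.restrict K) =
      ((volume.restrict (Icc a b)).prod μ).restrict (univ ×ˢ K) := by
    rw [← Measure.prod_restrict, Measure.restrict_univ]
  rw [h2] at h1
  refine IntegrableOn.integrable_of_forall_notMem_eq_zero h1 ?_
  rintro ⟨t, x⟩ hx
  exact h0 t x fun h => hx ⟨mem_univ _, h⟩

section Energy

variable {E : Type*} [NormedAddCommGroup E] [NormedSpace ℝ E]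
  [FiniteDimensional ℝ E] [MeasurableSpace E] [BorelSpace E] (μ : Measure E)
  [μ.IsAddHaarMeasure]

/-- Integration in time of `∂ₜ(V² θ) ψ²`, for a time weight `θ` vanishing at the initial time. -/
theorem integral_time_deriv_nonneg {V : ℝ × E → ℝ} (hV : ContDiff ℝ 1 V) {ψ : E → ℝ}
    (hψ : Continuous ψ) (hc : HasCompactSupport ψ) {θ : ℝ → ℝ} (hθ : ContDiff ℝ 1 θ)
    {a b : ℝ} (hab : a ≤ b) (ha : θ a = 0) (hb : 0 ≤ θ b) :
    0 ≤ ∫ p, ((2 * V p * fderiv ℝ V p (1, 0)) * θ p.1 + V p ^ 2 * deriv θ p.1) * ψ p.2 ^ 2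
      ∂((volume.restrict (Icc a b)).prod μ) := by
  have hP : Continuous fun p => fderiv ℝ V p (1, 0) :=
    (hV.continuous_fderiv one_ne_zero).clm_apply continuous_const
  have hVc := hV.continuous
  have hθc := hθ.continuous
  have hθ' : Continuous (deriv θ) := hθ.continuous_deriv le_rfl
  have hA : Continuous fun p : ℝ × E =>
      ((2 * V p * fderiv ℝ V p (1, 0)) * θ p.1 + V p ^ 2 * deriv θ p.1) * ψ p.2 ^ 2 := by
    fun_prop
  rw [integral_prod_symm _ (hA.integrable_Icc_prod μ hc
    (fun t x hx => by simp [image_eq_zero_of_notMem_tsupport hx]) a b)]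
  refine integral_nonneg fun x => ?_
  have hder : ∀ t ∈ uIcc a b, HasDerivAt (fun s => (V (s, x) ^ 2 * θ s) * ψ x ^ 2)
      (((2 * V (t, x) * fderiv ℝ V (t, x) (1, 0)) * θ t + V (t, x) ^ 2 * deriv θ t)
        * ψ x ^ 2) t := by
    intro t _
    have h1 := hasDerivAt_slice_left (hV.differentiable one_ne_zero (t, x))
    have h2 := (hθ.differentiable one_ne_zero t).hasDerivAt
    simpa using ((h1.fun_pow 2).fun_mul h2).mul_const (ψ x ^ 2)
  have hint : IntervalIntegrable (fun t =>
      ((2 * V (t, x) * fderiv ℝ V (t, x) (1, 0)) * θ t + V (t, x) ^ 2 * deriv θ t) * ψ x ^ 2)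
      volume a b :=
    (hA.comp (Continuous.prodMk_left x)).intervalIntegrable _ _
  have h := intervalIntegral.integral_eq_sub_of_hasDerivAt hder hint
  rw [intervalIntegral.integral_of_le hab, ← integral_Icc_eq_integral_Ioc] at h
  simp only [Pi.zero_apply]
  rw [h, ha]
  have := mul_nonneg (mul_nonneg (sq_nonneg (V (b, x))) hb) (sq_nonneg (ψ x))
  linarith

/-- Integration by parts in space, for the vector field `θ ψ² V (∂ᵥV) v`. -/
theorem integral_space_deriv_eq_zero {V : ℝ × E → ℝ} (hV : ContDiff ℝ 2 V) {ψ : E → ℝ}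
    (hψ : ContDiff ℝ 1 ψ) (hc : HasCompactSupport ψ) {θ : ℝ → ℝ} (hθ : Continuous θ)
    (a b : ℝ) (v : E) :
    Integrable (fun p : ℝ × E => θ p.1 * ((fderiv ℝ V p (0, v)) ^ 2 * ψ p.2 ^ 2
      + V p * fderiv ℝ (fun q => fderiv ℝ V q (0, v)) p (0, v) * ψ p.2 ^ 2
      + 2 * V p * fderiv ℝ V p (0, v) * ψ p.2 * fderiv ℝ ψ p.2 v))
      ((volume.restrict (Icc a b)).prod μ) ∧
    ∫ p, θ p.1 * ((fderiv ℝ V p (0, v)) ^ 2 * ψ p.2 ^ 2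
      + V p * fderiv ℝ (fun q => fderiv ℝ V q (0, v)) p (0, v) * ψ p.2 ^ 2
      + 2 * V p * fderiv ℝ V p (0, v) * ψ p.2 * fderiv ℝ ψ p.2 v)
      ∂((volume.restrict (Icc a b)).prod μ) = 0 := by
  have hQ : ContDiff ℝ 1 fun p => fderiv ℝ V p (0, v) :=
    (hV.fderiv_right (m := 1) (by norm_num)).clm_apply contDiff_const
  have hS : Continuous fun p => fderiv ℝ (fun q => fderiv ℝ V q (0, v)) p (0, v) :=
    (hQ.continuous_fderiv one_ne_zero).clm_apply continuous_const
  have hψ' : Continuous fun x => fderiv ℝ ψ x v :=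
    (hψ.continuous_fderiv one_ne_zero).clm_apply continuous_const
  have hVc := hV.continuous
  have hQc := hQ.continuous
  have hψc := hψ.continuous
  have hD : Continuous fun p : ℝ × E => θ p.1 * ((fderiv ℝ V p (0, v)) ^ 2 * ψ p.2 ^ 2
      + V p * fderiv ℝ (fun q => fderiv ℝ V q (0, v)) p (0, v) * ψ p.2 ^ 2
      + 2 * V p * fderiv ℝ V p (0, v) * ψ p.2 * fderiv ℝ ψ p.2 v) := by
    have : Continuous fun p : ℝ × E => fderiv ℝ ψ p.2 v := hψ'.comp continuous_snd
    fun_prop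
  have hI := hD.integrable_Icc_prod μ hc
    (fun t x hx => by simp [image_eq_zero_of_notMem_tsupport hx]) a b
  refine ⟨hI, ?_⟩
  rw [integral_prod _ hI]
  refine integral_eq_zero_of_ae (Filter.Eventually.of_forall fun t => ?_)
  have hder : ∀ x, fderiv ℝ (fun y => V (t, y) * fderiv ℝ V (t, y) (0, v) * ψ y ^ 2) x v =
      (fderiv ℝ V (t, x) (0, v)) ^ 2 * ψ x ^ 2
      + V (t, x) * fderiv ℝ (fun q => fderiv ℝ V q (0, v)) (t, x) (0, v) * ψ x ^ 2
      + 2 * V (t, x) * fderiv ℝ V (t, x) (0, v) * ψ x * fderiv ℝ ψ x v := by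
    intro x
    have h1 := hasFDerivAt_slice_right (hV.differentiable two_ne_zero (t, x))
    have h2 := hasFDerivAt_slice_right (hQ.differentiable one_ne_zero (t, x))
    have h3 := (hψ.differentiable one_ne_zero x).hasFDerivAt
    have h4 : HasFDerivAt (fun y => V (t, y) * fderiv ℝ V (t, y) (0, v) * ψ y ^ 2) _ x :=
      (h1.mul h2).mul (h3.pow 2)
    rw [h4.fderiv]
    simp
    ring
  have hc1 : ContDiff ℝ 1 fun y => V (t, y) * fderiv ℝ V (t, y) (0, v) * ψ y ^ 2 :=
    (((hV.of_le (by norm_num)).comp (contDiff_prodMk_right t)).mul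
      (hQ.comp (contDiff_prodMk_right t))).mul (hψ.pow 2)
  have hcs : HasCompactSupport fun y => V (t, y) * fderiv ℝ V (t, y) (0, v) * ψ y ^ 2 := by
    refine HasCompactSupport.mul_left ?_
    exact hc.comp_left (g := fun r : ℝ => r ^ 2) (by simp)
  have h0 := integral_fderiv_apply_eq_zero μ hc1 hcs v
  simp only [hder] at h0
  simp only [integral_const_mul, h0, mul_zero, Pi.zero_apply]

/-- Weighted energy inequality for solutions of `∂ₜV = ∑ᵢ ∂ᵢ∂ᵢV`. -/
theorem integral_energy_le {ι : Type*} [Fintype ι] (e : ι → E) {V : ℝ × E → ℝ}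
    (hV : ContDiff ℝ 2 V) {ψ : E → ℝ} (hψ : ContDiff ℝ 1 ψ) (hc : HasCompactSupport ψ)
    {θ : ℝ → ℝ} (hθ : ContDiff ℝ 1 θ) (hθ0 : ∀ t, 0 ≤ θ t) {a b : ℝ} (hab : a ≤ b)
    (ha : θ a = 0)
    (heat : ∀ t ∈ Icc a b, ∀ x ∈ tsupport ψ, fderiv ℝ V (t, x) (1, 0) =
      ∑ i, fderiv ℝ (fun q => fderiv ℝ V q (0, e i)) (t, x) (0, e i)) :
    ∫ p in Icc a b ×ˢ univ, θ p.1 * ψ p.2 ^ 2 * ∑ i, (fderiv ℝ V p (0, e i)) ^ 2 ∂(volume.prod μ) ≤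
    ∫ p in Icc a b ×ˢ univ, V p ^ 2 * (deriv θ p.1 * ψ p.2 ^ 2
      + 4 * θ p.1 * ∑ i, (fderiv ℝ ψ p.2 (e i)) ^ 2) ∂(volume.prod μ) := by
  rw [← Measure.prod_restrict, Measure.restrict_univ]
  have hV1 : ContDiff ℝ 1 V := hV.of_le (by norm_num)
  have hP : Continuous fun p => fderiv ℝ V p (1, 0) :=
    (hV1.continuous_fderiv one_ne_zero).clm_apply continuous_const
  have hQ : ∀ i, Continuous fun p => fderiv ℝ V p (0, e i) := fun i =>
    (hV1.continuous_fderiv one_ne_zero).clm_apply continuous_const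
  have hψ' : ∀ i, Continuous fun p : ℝ × E => fderiv ℝ ψ p.2 (e i) := fun i =>
    ((hψ.continuous_fderiv one_ne_zero).clm_apply continuous_const).comp continuous_snd
  have hVc := hV.continuous
  have hθc := hθ.continuous
  have hψc := hψ.continuous
  have hθ' : Continuous (deriv θ) := hθ.continuous_deriv le_rfl
  have hz : ∀ x ∉ tsupport ψ, ψ x = 0 := fun x hx => image_eq_zero_of_notMem_tsupport hx
  have hz' : ∀ x ∉ tsupport ψ, fderiv ℝ ψ x = 0 := fun x hx =>
    image_eq_zero_of_notMem_tsupport fun h => hx (tsupport_fderiv_subset ℝ h)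
  set ν := (volume.restrict (Icc a b)).prod μ
  have hA := integral_time_deriv_nonneg μ hV1 hψc hc hθ hab ha (hθ0 b)
  have hAi : Integrable (fun p : ℝ × E =>
      ((2 * V p * fderiv ℝ V p (1, 0)) * θ p.1 + V p ^ 2 * deriv θ p.1) * ψ p.2 ^ 2) ν := by
    refine Continuous.integrable_Icc_prod μ (by fun_prop) hc (fun t x hx => ?_) a b
    simp [hz x hx]
  have hD := fun i => integral_space_deriv_eq_zero μ hV hψ hc hθc a b (e i)
  have hDi := integrable_finsetSum Finset.univ fun i _ => (hD i).1
  have hD0 := integral_finsetSum Finset.univ fun i _ => (hD i).1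
  rw [Finset.sum_eq_zero fun i _ => (hD i).2] at hD0
  have hLi : Integrable (fun p : ℝ × E =>
      θ p.1 * ψ p.2 ^ 2 * ∑ i, (fderiv ℝ V p (0, e i)) ^ 2) ν := by
    refine Continuous.integrable_Icc_prod μ (by fun_prop) hc (fun t x hx => ?_) a b
    simp [hz x hx]
  have hRi : Integrable (fun p : ℝ × E => V p ^ 2 * (deriv θ p.1 * ψ p.2 ^ 2
      + 4 * θ p.1 * ∑ i, (fderiv ℝ ψ p.2 (e i)) ^ 2)) ν := by
    refine Continuous.integrable_Icc_prod μ (by fun_prop) hc (fun t x hx => ?_) a b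
    simp [hz x hx, hz' x hx]
  have key := integral_mono_ae (hLi.add hAi) (hRi.add (hDi.const_mul 2)) (by
    have ht : ∀ᵐ p ∂ν, p.1 ∈ Icc a b :=
      Measure.quasiMeasurePreserving_fst.ae (ae_restrict_mem measurableSet_Icc)
    filter_upwards [ht] with p hp
    obtain ⟨t, x⟩ := p
    simp only [Pi.add_apply]
    by_cases hx : x ∈ tsupport ψ
    · rw [heat t hp x hx]
      set Q := fun i => fderiv ℝ V (t, x) (0, e i)
      set S := fun i => fderiv ℝ (fun q => fderiv ℝ V q (0, e i)) (t, x) (0, e i)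
      set G := fun i => fderiv ℝ ψ x (e i)
      have hsq : 0 ≤ ∑ i, θ t * (Q i * ψ x + 2 * V (t, x) * G i) ^ 2 :=
        Finset.sum_nonneg fun i _ => mul_nonneg (hθ0 t) (sq_nonneg _)
      have hsq' : ∑ i, θ t * (Q i * ψ x + 2 * V (t, x) * G i) ^ 2 =
          θ t * ψ x ^ 2 * ∑ i, Q i ^ 2 + 4 * θ t * V (t, x) ^ 2 * ∑ i, G i ^ 2
            + 4 * θ t * V (t, x) * ψ x * ∑ i, Q i * G i := by
        simp only [Finset.mul_sum, ← Finset.sum_add_distrib]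
        exact Finset.sum_congr rfl fun i _ => by ring
      have hdiv : ∑ i, θ t * (Q i ^ 2 * ψ x ^ 2 + V (t, x) * S i * ψ x ^ 2
            + 2 * V (t, x) * Q i * ψ x * G i) =
          θ t * ψ x ^ 2 * ∑ i, Q i ^ 2 + θ t * V (t, x) * ψ x ^ 2 * ∑ i, S i
            + 2 * θ t * V (t, x) * ψ x * ∑ i, Q i * G i := by
        simp only [Finset.mul_sum, ← Finset.sum_add_distrib]
        exact Finset.sum_congr rfl fun i _ => by ring
      rw [hsq'] at hsq
      rw [hdiv]
      linarith
    · simp [hz x hx, hz' x hx])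
  rw [integral_add' hLi hAi, integral_add' hRi (hDi.const_mul 2), integral_const_mul, hD0] at key
  linarith

end Energy

theorem Real.smoothTransition.deriv_eq_zero_of_nonpos {x : ℝ} (hx : x ≤ 0) :
    deriv smoothTransition x = 0 := by
  refine IsLocalMin.deriv_eq_zero (Filter.Eventually.of_forall fun y => ?_)
  rw [smoothTransition.zero_of_nonpos hx]
  exact smoothTransition.nonneg y

theorem Real.smoothTransition.exists_abs_deriv_le :
    ∃ M > 0, ∀ x, |deriv smoothTransition x| ≤ M := by
  have hc : Continuous (deriv smoothTransition) :=
    (smoothTransition.contDiff (n := 1)).continuous_deriv le_rfl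
  obtain ⟨M, hM⟩ := (isCompact_Icc (a := (0 : ℝ)) (b := 1)).exists_bound_of_continuousOn
    hc.continuousOn
  refine ⟨max M 1, by positivity, fun x => ?_⟩
  rcases le_or_gt x 0 with h0 | h0
  · rw [smoothTransition.deriv_eq_zero_of_nonpos h0]; simp
  rcases le_or_gt 1 x with h1 | h1
  · have : deriv smoothTransition x = 0 := by
      refine IsLocalMax.deriv_eq_zero (Filter.Eventually.of_forall fun y => ?_)
      rw [smoothTransition.one_of_one_le h1]
      exact smoothTransition.le_one y
    rw [this]; simp
  · exact (hM x ⟨h0.le, h1.le⟩).trans (le_max_left _ _)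

/-- A smooth cutoff between concentric balls with the scale-invariant gradient bound. -/
theorem exists_ball_cutoff {E : Type*} [NormedAddCommGroup E] [InnerProductSpace ℝ E] {M : ℝ}
    (hM : ∀ x, |deriv smoothTransition x| ≤ M) (x₀ : E) {r R : ℝ} (hr : 0 ≤ r) (hrR : r < R) :
    ∃ ψ : E → ℝ, ContDiff ℝ 1 ψ ∧ (∀ x, 0 ≤ ψ x) ∧ (∀ x, ψ x ≤ 1) ∧
      (∀ x, ‖x - x₀‖ ≤ r → ψ x = 1) ∧ (∀ x, R ≤ ‖x - x₀‖ → ψ x = 0) ∧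
      (∀ x, R ≤ ‖x - x₀‖ → fderiv ℝ ψ x = 0) ∧
      ∀ x, ‖fderiv ℝ ψ x‖ ≤ 2 * M / (R - r) := by
  have hM0 : 0 ≤ M := (abs_nonneg _).trans (hM 0)
  have hpos : 0 < R ^ 2 - r ^ 2 := by nlinarith
  have hder : ∀ x, HasFDerivAt
      (fun x => smoothTransition ((R ^ 2 - ‖x - x₀‖ ^ 2) / (R ^ 2 - r ^ 2)))
      (deriv smoothTransition ((R ^ 2 - ‖x - x₀‖ ^ 2) / (R ^ 2 - r ^ 2)) •
        ((R ^ 2 - r ^ 2)⁻¹ • -((2 : ℕ) • innerSL ℝ (x - x₀) : E →L[ℝ] ℝ))) x := by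
    intro x
    have h1 : HasFDerivAt (fun x => ‖x - x₀‖ ^ 2) ((2 : ℕ) • innerSL ℝ (x - x₀)) x := by
      simpa using ((hasFDerivAt_id x).sub_const x₀).norm_sq
    have h2 : HasFDerivAt (fun x => (R ^ 2 - ‖x - x₀‖ ^ 2) / (R ^ 2 - r ^ 2))
        ((R ^ 2 - r ^ 2)⁻¹ • -((2 : ℕ) • innerSL ℝ (x - x₀) : E →L[ℝ] ℝ)) x := by
      simpa only [div_eq_mul_inv] using (h1.const_sub (R ^ 2)).mul_const (R ^ 2 - r ^ 2)⁻¹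
    exact ((smoothTransition.contDiff (n := 1)).differentiable one_ne_zero _).hasDerivAt
      |>.comp_hasFDerivAt x h2
  have hnonpos : ∀ x : E, R ≤ ‖x - x₀‖ → (R ^ 2 - ‖x - x₀‖ ^ 2) / (R ^ 2 - r ^ 2) ≤ 0 :=
    fun x hx => div_nonpos_of_nonpos_of_nonneg (by nlinarith) hpos.le
  have hzero : ∀ x : E, R ≤ ‖x - x₀‖ → fderiv ℝ
      (fun x => smoothTransition ((R ^ 2 - ‖x - x₀‖ ^ 2) / (R ^ 2 - r ^ 2))) x = 0 := by
    intro x hx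
    rw [(hder x).fderiv, smoothTransition.deriv_eq_zero_of_nonpos (hnonpos x hx), zero_smul]
  refine ⟨fun x => smoothTransition ((R ^ 2 - ‖x - x₀‖ ^ 2) / (R ^ 2 - r ^ 2)), ?_,
    fun x => smoothTransition.nonneg _, fun x => smoothTransition.le_one _, fun x hx => ?_,
    fun x hx => smoothTransition.zero_of_nonpos (hnonpos x hx), hzero, fun x => ?_⟩
  · refine (smoothTransition.contDiff (n := 1)).comp ?_
    exact (contDiff_const.sub ((contDiff_id.sub contDiff_const).norm_sq ℝ)).div_const _
  · refine smoothTransition.one_of_one_le ?_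
    rw [one_le_div hpos]
    nlinarith [norm_nonneg (x - x₀)]
  · rcases le_or_gt R ‖x - x₀‖ with hx | hx
    · rw [hzero x hx, norm_zero]
      exact div_nonneg (by positivity) (sub_pos.2 hrR).le
    · rw [(hder x).fderiv, norm_smul, norm_smul, norm_neg, ← Nat.cast_smul_eq_nsmul ℝ, norm_smul,
        innerSL_apply_norm, norm_inv, Real.norm_eq_abs, Real.norm_of_nonneg hpos.le]
      calc _ ≤ M * ((R ^ 2 - r ^ 2)⁻¹ * (2 * (R + r))) := by
            gcongr
            · exact hM _
            · simp
            · linarith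
        _ = _ := by
            have h1 : R - r ≠ 0 := (sub_pos.2 hrR).ne'
            have h2 : R + r ≠ 0 := by linarith
            rw [show R ^ 2 - r ^ 2 = (R - r) * (R + r) by ring]
            field_simp

/-- A smooth function near a closed set agrees near that set with a globally smooth function. -/
theorem exists_contDiff_eventuallyEq_of_isClosed {E : Type*} [NormedAddCommGroup E]
    [NormedSpace ℝ E] [FiniteDimensional ℝ E] {K U : Set E} (hK : IsClosed K) (hU : IsOpen U)
    (hKU : K ⊆ U) {v : E → ℝ} {n : ℕ} (hv : ContDiffOn ℝ n v U) :
    ∃ V : E → ℝ, ContDiff ℝ n V ∧ ∀ p ∈ K, V =ᶠ[nhds p] v := by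
  obtain ⟨χ, h0, h1, -⟩ := exists_contMDiffMap_zero_one_nhds_of_isClosed (n := n)
    (modelWithCornersSelf ℝ E) hU.isClosed_compl hK (disjoint_compl_left_iff_subset.2 hKU)
  have hχ : ContDiff ℝ n χ := χ.contMDiff.contDiff
  refine ⟨fun p => χ p * v p, contDiff_iff_contDiffAt.2 fun p => ?_, fun p hp => ?_⟩
  · by_cases hp : p ∈ U
    · exact hχ.contDiffAt.mul (hv.contDiffAt (hU.mem_nhds hp))
    · refine (contDiffAt_const (c := (0 : ℝ))).congr_of_eventuallyEq ?_
      filter_upwards [Filter.Eventually.filter_mono (nhds_le_nhdsSet hp) h0] with q hq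
      simp [hq]
  · filter_upwards [Filter.Eventually.filter_mono (nhds_le_nhdsSet hp) h1] with q hq
    simp [hq]

theorem norm_gradient_eq_norm_fderiv {E : Type*} [NormedAddCommGroup E] [InnerProductSpace ℝ E]
    [CompleteSpace E] (f : E → ℝ) (x : E) : ‖gradient f x‖ = ‖fderiv ℝ f x‖ := by
  rw [← toDual_gradient, LinearIsometryEquiv.norm_map]

theorem sum_fderiv_single_sq {d : ℕ} (f : EuclideanSpace ℝ (Fin d) → ℝ)
    (x : EuclideanSpace ℝ (Fin d)) :
    ∑ i, (fderiv ℝ f x (EuclideanSpace.single i 1)) ^ 2 = ‖gradient f x‖ ^ 2 := by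
  rw [EuclideanSpace.real_norm_sq_eq]
  refine Finset.sum_congr rfl fun i _ => ?_
  rw [← inner_gradient_left, EuclideanSpace.inner_single_right]
  simp

/-- **Caccioppoli (energy) estimate.** For a smooth solution of the heat equation on
(a neighborhood of) `[-1,0] × ℝ^d`, with
`Ω²_j = {(t,x) : |x-x₀| < (j+0.5)/√k, t ∈ [-(j+0.5)/k,0]}` and
`Ω¹_{j+1} = {(t,x) : |x-x₀| < (j+1)/√k, t ∈ [-(j+1)/k,0]}`, one has
`∫_{Ω²_j} |∇u|² ≤ C k ∫_{Ω¹_{j+1}} u²`, where `C` depends only on `d`. -/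
theorem caccioppoli_gradient (d : ℕ) :
    ∃ C > (0:ℝ),
      ∀ (u : ℝ → EuclideanSpace ℝ (Fin d) → ℝ),
      ∀ U : Set (ℝ × EuclideanSpace ℝ (Fin d)), IsOpen U →
        (Set.Icc (-1:ℝ) 0 ×ˢ (Set.univ : Set (EuclideanSpace ℝ (Fin d)))) ⊆ U →
        ContDiffOn ℝ (⊤ : ℕ∞) (fun p : ℝ × EuclideanSpace ℝ (Fin d) => u p.1 p.2) U →
        (∀ p ∈ U, deriv (fun s => u s p.2) p.1 = Lap (u p.1) p.2) →
        ∀ (x₀ : EuclideanSpace ℝ (Fin d)) (k j : ℕ), 1 ≤ k → 1 ≤ j → j + 1 ≤ k →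
        (∫ p in {p : ℝ × EuclideanSpace ℝ (Fin d) |
            ‖p.2 - x₀‖ < ((j:ℝ) + 0.5) / Real.sqrt k ∧ p.1 ∈ Set.Icc (-((j:ℝ)+0.5)/k) 0},
          ‖gradient (u p.1) p.2‖^2 ∂volume)
        ≤ C * k * ∫ p in {p : ℝ × EuclideanSpace ℝ (Fin d) |
            ‖p.2 - x₀‖ < ((j:ℝ) + 1) / Real.sqrt k ∧ p.1 ∈ Set.Icc (-((j:ℝ)+1)/k) 0},
          (u p.1 p.2)^2 ∂volume := by
  obtain ⟨M, hM0, hM⟩ := Real.smoothTransition.exists_abs_deriv_le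
  refine ⟨2 * M + 64 * M ^ 2, by positivity, ?_⟩
  intro u U hU hKU hu hheat x₀ k j hk hj hjk
  obtain ⟨V, hV, hVu⟩ := exists_contDiff_eventuallyEq_of_isClosed (n := 2)
    (isClosed_Icc.prod isClosed_univ) hU hKU (hu.of_le (by simpa using WithTop.coe_le_coe.2 (le_top : (2 : ℕ∞) ≤ ⊤)))
  have hV : ContDiff ℝ 2 V := by exact_mod_cast hV
  have hslice : ∀ t ∈ Icc (-1 : ℝ) 0, u t = fun y => V (t, y) := fun t ht =>
    funext fun y => ((hVu (t, y) ⟨ht, mem_univ _⟩).self_of_nhds).symm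
  have hkpos : (0 : ℝ) < k := by exact_mod_cast hk
  have hsk : 0 < √(k : ℝ) := Real.sqrt_pos.2 hkpos
  have hsk2 : √(k : ℝ) ^ 2 = k := Real.sq_sqrt hkpos.le
  have hjk' : (j : ℝ) + 1 ≤ k := by exact_mod_cast hjk
  have hj0 : (0 : ℝ) ≤ j := j.cast_nonneg
  set a : ℝ := -((j : ℝ) + 1) / k with ha
  have hka : k * a = -((j : ℝ) + 1) := by rw [ha]; field_simp
  have ha0 : a ≤ 0 := by nlinarith
  have ha1 : -1 ≤ a := by nlinarith
  set r : ℝ := ((j : ℝ) + 0.5) / √(k : ℝ)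
  set R : ℝ := ((j : ℝ) + 1) / √(k : ℝ)
  have hRr : R - r = (2 * √(k : ℝ))⁻¹ := by
    simp only [r, R]; field_simp; norm_num
  obtain ⟨ψ, hψ, hψ0, hψ1, hψr, hψR, hψR', hψM⟩ := exists_ball_cutoff hM x₀ (r := r) (R := R)
    (by positivity) (by have : 0 < (2 * √(k : ℝ))⁻¹ := by positivity
                        linarith)
  have hsupp : tsupport ψ ⊆ Metric.closedBall x₀ R := by
    refine closure_minimal (fun x hx => ?_) Metric.isClosed_closedBall
    rw [mem_closedBall_iff_norm]
    by_contra! h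
    exact hx (hψR x h.le)
  have hcs : HasCompactSupport ψ := (isCompact_closedBall x₀ R).of_isClosed_subset
    (isClosed_tsupport ψ) hsupp
  have hψgrad : ∀ x, ∑ i, (fderiv ℝ ψ x (EuclideanSpace.single i 1)) ^ 2 ≤ 16 * M ^ 2 * k := by
    intro x
    rw [sum_fderiv_single_sq, norm_gradient_eq_norm_fderiv]
    calc ‖fderiv ℝ ψ x‖ ^ 2 ≤ (2 * M / (R - r)) ^ 2 := by gcongr; exact hψM x
      _ = 16 * M ^ 2 * √(k : ℝ) ^ 2 := by rw [hRr, div_inv_eq_mul]; ring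
      _ = _ := by rw [hsk2]
  set θ : ℝ → ℝ := fun t => smoothTransition (2 * k * (t - a))
  have hθ : ContDiff ℝ 1 θ := (smoothTransition.contDiff (n := 1)).comp
    (contDiff_const.mul (contDiff_id.sub contDiff_const))
  have hθ' : ∀ t, deriv θ t ≤ 2 * k * M := by
    intro t
    have h1 : HasDerivAt (fun t => 2 * k * (t - a)) (2 * k) t := by
      simpa using ((hasDerivAt_id t).sub_const a).const_mul (2 * (k : ℝ))
    have h2 : HasDerivAt θ (deriv smoothTransition (2 * k * (t - a)) * (2 * k)) t :=
      ((smoothTransition.contDiff (n := 1)).differentiable one_ne_zero _).hasDerivAt.comp t h1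
    rw [h2.deriv, mul_comm]
    gcongr
    exact (le_abs_self _).trans (hM _)
  have hθ0 : ∀ t, 0 ≤ θ t := fun t => smoothTransition.nonneg _
  have hθ1 : ∀ t, θ t ≤ 1 := fun t => smoothTransition.le_one _
  have hE := integral_energy_le (volume : Measure (EuclideanSpace ℝ (Fin d)))
    (fun i => EuclideanSpace.single i (1 : ℝ)) hV hψ hcs hθ hθ0 ha0
    (smoothTransition.zero_of_nonpos (by simp)) (by
      intro t ht x _
      have ht' : t ∈ Icc (-1 : ℝ) 0 := ⟨ha1.trans ht.1, ht.2⟩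
      have hmem : (t, x) ∈ Icc (-1 : ℝ) 0 ×ˢ (univ : Set (EuclideanSpace ℝ (Fin d))) :=
        ⟨ht', mem_univ _⟩
      have h1 := hasDerivAt_slice_left (hV.differentiable two_ne_zero (t, x))
      have h2 : (fun s => u s x) =ᶠ[nhds t] fun s => V (s, x) :=
        ((Continuous.prodMk_left x).tendsto t).eventually (hVu _ hmem).symm
      rw [← h1.deriv, ← h2.deriv_eq, hheat _ (hKU hmem)]
      simp only [Lap, hslice t ht']
      refine Finset.sum_congr rfl fun i _ => ?_
      have hQ : ContDiff ℝ 1 fun p => fderiv ℝ V p (0, EuclideanSpace.single i 1) :=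
        (hV.fderiv_right (m := 1) (by norm_num)).clm_apply contDiff_const
      have h3 : (fun y => fderiv ℝ (fun y => V (t, y)) y (EuclideanSpace.single i 1)) =
          fun y => fderiv ℝ V (t, y) (0, EuclideanSpace.single i 1) := by
        funext y
        rw [(hasFDerivAt_slice_right (hV.differentiable two_ne_zero (t, y))).fderiv]
        simp
      rw [h3, (hasFDerivAt_slice_right (hQ.differentiable one_ne_zero (t, x))).fderiv]
      simp)
  rw [← Measure.volume_eq_prod] at hE
  have hgrad : ∀ t ∈ Icc (-1 : ℝ) 0, ∀ x, ‖gradient (u t) x‖ ^ 2 =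
      ∑ i, (fderiv ℝ V (t, x) (0, EuclideanSpace.single i 1)) ^ 2 := by
    intro t ht x
    rw [hslice t ht, ← sum_fderiv_single_sq,
      (hasFDerivAt_slice_right (hV.differentiable two_ne_zero (t, x))).fderiv]
    simp
  set Ω₂ := {p : ℝ × EuclideanSpace ℝ (Fin d) |
    ‖p.2 - x₀‖ < r ∧ p.1 ∈ Icc (-((j : ℝ) + 0.5) / k) 0}
  set Ω₁ := {p : ℝ × EuclideanSpace ℝ (Fin d) | ‖p.2 - x₀‖ < R ∧ p.1 ∈ Icc a 0}
  have hball : ∀ ρ : ℝ, MeasurableSet {p : ℝ × EuclideanSpace ℝ (Fin d) | ‖p.2 - x₀‖ < ρ} :=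
    fun ρ => (isOpen_lt (by fun_prop) continuous_const).measurableSet
  have hmΩ₂ : MeasurableSet Ω₂ := (hball r).inter (measurable_fst measurableSet_Icc)
  have hmΩ₁ : MeasurableSet Ω₁ := (hball R).inter (measurable_fst measurableSet_Icc)
  have haΩ₂ : a ≤ -((j : ℝ) + 0.5) / k := by
    rw [ha]; gcongr; norm_num
  have hcompact : IsCompact (Icc a 0 ×ˢ Metric.closedBall x₀ R) :=
    isCompact_Icc.prod (isCompact_closedBall x₀ R)
  have hint : ∀ {F : ℝ × EuclideanSpace ℝ (Fin d) → ℝ}, Continuous F → IntegrableOn F Ω₁ :=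
    fun hF => (hF.continuousOn.integrableOn_compact hcompact).mono_set
      fun p hp => ⟨hp.2, mem_closedBall_iff_norm.2 hp.1.le⟩
  have hQ : ∀ i : Fin d, Continuous fun p => fderiv ℝ V p (0, EuclideanSpace.single i 1) :=
    fun i => (hV.continuous_fderiv two_ne_zero).clm_apply continuous_const
  have hG : ∀ i : Fin d, Continuous fun p : ℝ × EuclideanSpace ℝ (Fin d) =>
      fderiv ℝ ψ p.2 (EuclideanSpace.single i 1) := fun i =>
    ((hψ.continuous_fderiv one_ne_zero).clm_apply continuous_const).comp continuous_snd
  have hVc := hV.continuous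
  have hθc := hθ.continuous
  have hψc := hψ.continuous
  have hθ'c : Continuous (deriv θ) := hθ.continuous_deriv le_rfl
  have hzero : ∀ p ∈ (Icc a 0 ×ˢ univ) \ Ω₁, R ≤ ‖p.2 - x₀‖ := by
    intro p hp
    by_contra! h
    exact hp.2 ⟨h, hp.1.1⟩
  have hΩ₁sub : Ω₁ ⊆ Icc a 0 ×ˢ univ := fun p hp => ⟨hp.2, mem_univ _⟩
  have hmS : MeasurableSet (Icc a 0 ×ˢ (univ : Set (EuclideanSpace ℝ (Fin d)))) :=
    measurableSet_Icc.prod MeasurableSet.univ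
  have hL : IntegrableOn (fun p : ℝ × EuclideanSpace ℝ (Fin d) => θ p.1 * ψ p.2 ^ 2 *
      ∑ i, (fderiv ℝ V p (0, EuclideanSpace.single i 1)) ^ 2) (Icc a 0 ×ˢ univ) := by
    refine (hint (by fun_prop)).of_forall_sdiff_eq_zero hmS fun p hp => ?_
    simp [hψR _ (hzero p hp)]
  calc ∫ p in Ω₂, ‖gradient (u p.1) p.2‖ ^ 2
      = ∫ p in Ω₂, θ p.1 * ψ p.2 ^ 2 *
          ∑ i, (fderiv ℝ V p (0, EuclideanSpace.single i 1)) ^ 2 := by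
        refine setIntegral_congr_fun hmΩ₂ fun p hp => ?_
        have hθp : θ p.1 = 1 := by
          refine smoothTransition.one_of_one_le ?_
          have h1 : -((j : ℝ) + 0.5) ≤ p.1 * k := (div_le_iff₀ hkpos).1 hp.2.1
          norm_num at h1
          linarith
        simp only [hgrad p.1 ⟨ha1.trans (haΩ₂.trans hp.2.1), hp.2.2⟩, hθp, hψr p.2 hp.1.le]
        ring
    _ ≤ ∫ p in Icc a 0 ×ˢ univ, θ p.1 * ψ p.2 ^ 2 *
          ∑ i, (fderiv ℝ V p (0, EuclideanSpace.single i 1)) ^ 2 := by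
        refine setIntegral_mono_set hL (Filter.Eventually.of_forall fun p => ?_)
          (LE.le.eventuallyLE fun p hp => ⟨⟨haΩ₂.trans hp.2.1, hp.2.2⟩, mem_univ _⟩)
        exact mul_nonneg (mul_nonneg (hθ0 _) (sq_nonneg _))
          (Finset.sum_nonneg fun i _ => sq_nonneg _)
    _ ≤ _ := hE
    _ = ∫ p in Ω₁, V p ^ 2 * (deriv θ p.1 * ψ p.2 ^ 2
          + 4 * θ p.1 * ∑ i, (fderiv ℝ ψ p.2 (EuclideanSpace.single i 1)) ^ 2) := by
        refine setIntegral_eq_of_subset_of_forall_sdiff_eq_zero hmS hΩ₁sub fun p hp => ?_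
        simp [hψR _ (hzero p hp), hψR' _ (hzero p hp)]
    _ ≤ ∫ p in Ω₁, (2 * M + 64 * M ^ 2) * k * V p ^ 2 := by
        refine setIntegral_mono_on (hint (by fun_prop)) (hint (by fun_prop)) hmΩ₁ fun p _ => ?_
        rw [mul_comm]
        refine mul_le_mul_of_nonneg_right ?_ (sq_nonneg _)
        have h1 : deriv θ p.1 * ψ p.2 ^ 2 ≤ 2 * k * M * 1 :=
          mul_le_mul (hθ' _) (pow_le_one₀ (hψ0 _) (hψ1 _)) (sq_nonneg _) (by positivity)
        have h2 : θ p.1 * ∑ i, (fderiv ℝ ψ p.2 (EuclideanSpace.single i 1)) ^ 2 ≤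
            1 * (16 * M ^ 2 * k) :=
          mul_le_mul (hθ1 _) (hψgrad _) (Finset.sum_nonneg fun i _ => sq_nonneg _) zero_le_one
        linarith
    _ = (2 * M + 64 * M ^ 2) * k * ∫ p in Ω₁, (u p.1 p.2) ^ 2 := by
        rw [integral_const_mul]
        congr 1
        refine setIntegral_congr_fun hmΩ₁ fun p hp => ?_
        simp only [hslice p.1 ⟨ha1.trans hp.2.1, hp.2.2⟩]
end

section
/- There exists a universal constant C₀ > 0 depending only on d with the following property. Let u be a smooth solution of the heat equation ∂_t u = Δu on [−1,0] × ℝ^d, let x₀ ∈ ℝ^d, let k ≥ 1 be an integer, and let 1 ≤ j ≤ k − 1 be an integer. Set Ω¹_j = {(t,x) : |x − x₀| < j/√k, t ∈ [−j/k, 0]}. Then ∫_{Ω¹_j} (∂_t u)² dx dt ≤ C₀ k² ∫_{Ω¹_{j+1}} u² dx dt. -/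
open Real Set MeasureTheory

section SlabIntegrals

variable {E : Type*} [NormedAddCommGroup E] [NormedSpace ℝ E]

/-- The directional derivative of `f` in the direction `w`. -/
noncomputable def dirDeriv {V : Type*} [NormedAddCommGroup V] [NormedSpace ℝ V]
    (w : V) (f : V → ℝ) (p : V) : ℝ :=
  fderiv ℝ f p w

theorem ContDiff.dirDeriv {f : E → ℝ} (hf : ContDiff ℝ (⊤ : ℕ∞) f) (w : E) :
    ContDiff ℝ (⊤ : ℕ∞) (dirDeriv w f) :=
  (hf.fderiv_right (m := (⊤ : ℕ∞)) (by simp)).clm_apply contDiff_const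

theorem ContDiff.dirDeriv_comm {f : E → ℝ} (hf : ContDiff ℝ (⊤ : ℕ∞) f) (w z : E) (p : E) :
    _root_.dirDeriv w (_root_.dirDeriv z f) p = _root_.dirDeriv z (_root_.dirDeriv w f) p := by
  have hs : IsSymmSndFDerivAt ℝ f p :=
    hf.contDiffAt.isSymmSndFDerivAt (by
      rw [minSmoothness_of_isRCLikeNormedField]
      exact WithTop.coe_le_coe.2 (le_top : (2 : ℕ∞) ≤ ⊤))
  have hd : DifferentiableAt ℝ (fderiv ℝ f) p :=
    ((hf.fderiv_right (m := (⊤ : ℕ∞)) (by simp)).differentiable (by simp)) p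
  have key : ∀ a b : E, _root_.dirDeriv a (_root_.dirDeriv b f) p = fderiv ℝ (fderiv ℝ f) p a b := by
    intro a b
    have h := (hd.hasFDerivAt.clm_apply (hasFDerivAt_const b p)).fderiv
    change fderiv ℝ (fun y => fderiv ℝ f y b) p a = _
    rw [h]; simp
  rw [key, key]; exact hs w z

theorem dirDeriv_eq_zero_of_eventuallyEq {f : E → ℝ} {p : E} (h : f =ᶠ[nhds p] fun _ => 0)
    (w : E) : dirDeriv w f p = 0 := by
  simp [dirDeriv, h.fderiv_eq]

theorem dirDeriv_eq_zero_of_forall_lt_norm {f : ℝ × E → ℝ} {x₀ : E} {R : ℝ}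
    (h : ∀ p : ℝ × E, R < ‖p.2 - x₀‖ → f p = 0) (w : ℝ × E) (p : ℝ × E) (hp : R < ‖p.2 - x₀‖) :
    dirDeriv w f p = 0 := by
  apply dirDeriv_eq_zero_of_eventuallyEq
  have ho : IsOpen {p : ℝ × E | R < ‖p.2 - x₀‖} :=
    isOpen_lt continuous_const (by fun_prop)
  filter_upwards [ho.mem_nhds hp] with q hq using h q hq

variable [FiniteDimensional ℝ E] [MeasureSpace E] [BorelSpace E]
  [(volume : Measure E).IsAddHaarMeasure]

theorem integrableOn_Icc_prod_univ {g : ℝ × E → ℝ} (hg : Continuous g) {x₀ : E} {R : ℝ}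
    (h : ∀ p : ℝ × E, R < ‖p.2 - x₀‖ → g p = 0) (a b : ℝ) :
    IntegrableOn g (Icc a b ×ˢ univ) := by
  have hK : IsCompact (Icc a b ×ˢ Metric.closedBall x₀ R) :=
    isCompact_Icc.prod (isCompact_closedBall x₀ R)
  refine (hg.continuousOn.integrableOn_compact hK).of_forall_sdiff_eq_zero
    (measurableSet_Icc.prod MeasurableSet.univ) ?_
  rintro p ⟨hp, hpn⟩
  apply h
  by_contra hc
  exact hpn ⟨hp.1, by simpa [dist_eq_norm] using hc⟩

/-- Spatial derivatives of spatially compactly supported functions integrate to zero. -/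
theorem setIntegral_dirDeriv_space_eq_zero {f : ℝ × E → ℝ} (hf : ContDiff ℝ (⊤ : ℕ∞) f)
    {x₀ : E} {R : ℝ} (h : ∀ p : ℝ × E, R < ‖p.2 - x₀‖ → f p = 0) (a b : ℝ) (w : E) :
    ∫ p in Icc a b ×ˢ univ, dirDeriv ((0 : ℝ), w) f p = 0 := by
  have hint := integrableOn_Icc_prod_univ (hf.dirDeriv ((0 : ℝ), w)).continuous
    (dirDeriv_eq_zero_of_forall_lt_norm h _) a b
  rw [Measure.volume_eq_prod] at hint ⊢
  rw [setIntegral_prod _ hint]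
  refine integral_eq_zero_of_ae (.of_forall fun t => ?_)
  have hsub : ∀ {g : E → ℝ}, (∀ x, R < ‖x - x₀‖ → g x = 0) → HasCompactSupport g := fun hg =>
    HasCompactSupport.intro (isCompact_closedBall x₀ R) fun x hx =>
      hg x (by simpa [dist_eq_norm] using hx)
  have hft : ContDiff ℝ (⊤ : ℕ∞) (fun x => f (t, x)) := hf.comp (contDiff_prodMk_right t)
  have hD : ∀ x, fderiv ℝ (fun x => f (t, x)) x w = dirDeriv ((0 : ℝ), w) f (t, x) := by
    intro x
    have h1 : HasFDerivAt f (fderiv ℝ f (t, x)) (t, x) :=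
      (hf.differentiable (by simp) _).hasFDerivAt
    have h2 := h1.comp x (hasFDerivAt_prodMk_right t x)
    rw [show (fun x => f (t, x)) = f ∘ (fun x => (t, x)) from rfl, h2.fderiv]
    simp [dirDeriv]
  have hi1 : Integrable (fun x => fderiv ℝ (fun x => f (t, x)) x w) := by
    refine Continuous.integrable_of_hasCompactSupport ?_ (hsub ?_)
    · exact ((hft.dirDeriv w).continuous : _)
    · intro x hx
      rw [hD]
      exact dirDeriv_eq_zero_of_forall_lt_norm h _ _ hx
  have hi2 : Integrable (fun x => f (t, x)) :=
    hft.continuous.integrable_of_hasCompactSupport (hsub fun x hx => h _ hx)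
  have := integral_mul_fderiv_eq_neg_fderiv_mul_of_integrable (μ := (volume : Measure E))
    (f := fun x => f (t, x)) (g := fun _ => (1 : ℝ)) (v := w)
    (by simpa using hi1) (by simp) (by simpa using hi2)
    (fun x _ => hft.differentiable (by simp) x) (fun x _ => by fun_prop)
  simp only [hD] at this
  simpa using this

theorem setIntegral_dirDeriv_time_nonneg {f : ℝ × E → ℝ} (hf : ContDiff ℝ (⊤ : ℕ∞) f)
    {x₀ : E} {R : ℝ} (h : ∀ p : ℝ × E, R < ‖p.2 - x₀‖ → f p = 0) {a b : ℝ} (hab : a ≤ b)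
    (hle : ∀ x, f (a, x) ≤ f (b, x)) :
    0 ≤ ∫ p in Icc a b ×ˢ univ, dirDeriv ((1 : ℝ), (0 : E)) f p := by
  have hint := integrableOn_Icc_prod_univ (hf.dirDeriv ((1 : ℝ), (0 : E))).continuous
    (dirDeriv_eq_zero_of_forall_lt_norm h _) a b
  rw [Measure.volume_eq_prod] at hint ⊢
  rw [← setIntegral_prod_swap, setIntegral_prod _ (by
    rw [IntegrableOn, ← Measure.prod_restrict] at hint ⊢; exact hint.swap)]
  refine integral_nonneg fun x => ?_
  simp only [Prod.swap_prod_mk]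
  have hD : ∀ t, HasDerivAt (fun s => f (s, x)) (dirDeriv ((1 : ℝ), (0 : E)) f (t, x)) t := by
    intro t
    have h1 : HasFDerivAt f (fderiv ℝ f (t, x)) (t, x) :=
      (hf.differentiable (by simp) _).hasFDerivAt
    exact h1.comp_hasDerivAt t ((hasDerivAt_id t).prodMk (hasDerivAt_const t x))
  rw [integral_Icc_eq_integral_Ioc, ← intervalIntegral.integral_of_le hab,
    intervalIntegral.integral_eq_sub_of_hasDerivAt (fun t _ => hD t)]
  · simpa using hle x
  · apply Continuous.intervalIntegrable
    exact (hf.dirDeriv _).continuous.comp (by fun_prop)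

end SlabIntegrals

section Energy

variable {V : Type*} [NormedAddCommGroup V] [NormedSpace ℝ V] {ι : Type*} [Fintype ι]

theorem dirDeriv_energy {η v : V → ℝ} (hη : ContDiff ℝ (⊤ : ℕ∞) η) (hv : ContDiff ℝ (⊤ : ℕ∞) v)
    (A : ℝ) (e : ι → V) (w p : V) :
    dirDeriv w (fun q => η q ^ 4 * (∑ i, dirDeriv (e i) v q ^ 2) / 2
        + A * η q ^ 2 * v q ^ 2 / 2) p =
      2 * η p ^ 3 * dirDeriv w η p * (∑ i, dirDeriv (e i) v p ^ 2)
        + η p ^ 4 * (∑ i, dirDeriv (e i) v p * dirDeriv (e i) (dirDeriv w v) p)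
        + A * η p * dirDeriv w η p * v p ^ 2 + A * η p ^ 2 * v p * dirDeriv w v p := by
  have h1 : HasFDerivAt η (fderiv ℝ η p) p := (hη.differentiable (by simp) p).hasFDerivAt
  have h2 : HasFDerivAt v (fderiv ℝ v p) p := (hv.differentiable (by simp) p).hasFDerivAt
  have h3 : ∀ i, HasFDerivAt (dirDeriv (e i) v) (fderiv ℝ (dirDeriv (e i) v) p) p := fun i =>
    ((hv.dirDeriv (e i)).differentiable (by simp) p).hasFDerivAt
  have h4 := (((h1.pow 4).mul (HasFDerivAt.fun_sum (u := Finset.univ)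
    fun i _ => (h3 i).pow 2)).mul_const (1 / 2)).add
    ((((h1.pow 2).const_mul A).mul (h2.pow 2)).mul_const (1 / 2))
  have h5 := (h4.congr_of_eventuallyEq (f₁ := fun q => η q ^ 4 * (∑ i, dirDeriv (e i) v q ^ 2) / 2
    + A * η q ^ 2 * v q ^ 2 / 2)
    (.of_forall fun q => by simp only [Pi.add_apply, Pi.mul_apply]; ring)).fderiv
  simp only [hv.dirDeriv_comm (e _) w]
  unfold dirDeriv at h5 ⊢
  rw [h5]
  simp
  rw [show (∑ i, 2 * (fderiv ℝ v p) (e i) * (fderiv ℝ (fun p => (fderiv ℝ v p) (e i)) p) w)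
    = 2 * ∑ i, (fderiv ℝ v p) (e i) * (fderiv ℝ (fun p => (fderiv ℝ v p) (e i)) p) w by
      rw [Finset.mul_sum]; exact Finset.sum_congr rfl fun i _ => by ring]
  ring

theorem dirDeriv_flux {η v f : V → ℝ} (hη : ContDiff ℝ (⊤ : ℕ∞) η) (hv : ContDiff ℝ (⊤ : ℕ∞) v)
    (hf : ContDiff ℝ (⊤ : ℕ∞) f) (A : ℝ) (w p : V) :
    dirDeriv w (fun q => η q ^ 4 * f q * dirDeriv w v q + A * η q ^ 2 * v q * dirDeriv w v q) p =
      η p ^ 3 * (4 * f p * (dirDeriv w η p * dirDeriv w v p))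
        + η p ^ 4 * (dirDeriv w v p * dirDeriv w f p)
        + η p ^ 4 * f p * dirDeriv w (dirDeriv w v) p
        + 2 * A * η p * v p * (dirDeriv w η p * dirDeriv w v p)
        + A * η p ^ 2 * dirDeriv w v p ^ 2
        + A * η p ^ 2 * v p * dirDeriv w (dirDeriv w v) p := by
  have h1 : HasFDerivAt η (fderiv ℝ η p) p := (hη.differentiable (by simp) p).hasFDerivAt
  have h2 : HasFDerivAt v (fderiv ℝ v p) p := (hv.differentiable (by simp) p).hasFDerivAt
  have h3 : HasFDerivAt f (fderiv ℝ f p) p := (hf.differentiable (by simp) p).hasFDerivAt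
  have h4 : HasFDerivAt (dirDeriv w v) (fderiv ℝ (dirDeriv w v) p) p :=
    ((hv.dirDeriv w).differentiable (by simp) p).hasFDerivAt
  have h5 := (((h1.pow 4).mul h3).mul h4).add ((((h1.pow 2).const_mul A).mul h2).mul h4)
  have h6 := (h5.congr_of_eventuallyEq (f₁ := fun q =>
    η q ^ 4 * f q * dirDeriv w v q + A * η q ^ 2 * v q * dirDeriv w v q)
    (.of_forall fun q => by simp only [Pi.add_apply, Pi.mul_apply])).fderiv
  unfold dirDeriv at h6 ⊢
  rw [h6]
  simp
  ring

/-- The pointwise algebraic inequality behind the energy estimate. -/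
theorem energy_dissipation_le {η ηt ut u g c h K : ℝ} (hK : 0 ≤ K) (hη0 : 0 ≤ η) (hη1 : η ≤ 1)
    (hηt : |ηt| ≤ K) (hh : h ≤ K) (hg : 0 ≤ g) (hc : c ^ 2 ≤ h * g) :
    2 * η ^ 3 * ηt * g - η ^ 4 * ut ^ 2 - 4 * η ^ 3 * ut * c
      + 20 * K * (η * ηt * u ^ 2 - 2 * η * u * c - η ^ 2 * g)
      ≤ - (1 / 2) * (η ^ 4 * ut ^ 2) + 60 * K ^ 2 * u ^ 2 := by
  have hcK : c ^ 2 ≤ K * g := hc.trans (by gcongr)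
  have hηt' := (abs_le.1 hηt).2
  have a1 : η ^ 3 * ηt * g ≤ η ^ 2 * K * g := by
    have : η * ηt ≤ K := by nlinarith
    calc η ^ 3 * ηt * g = η ^ 2 * (η * ηt) * g := by ring
      _ ≤ _ := by gcongr
  have a2 : - 4 * η ^ 3 * ut * c ≤ 1 / 2 * (η ^ 4 * ut ^ 2) + 8 * η ^ 2 * (K * g) := by
    have : η ^ 2 * c ^ 2 ≤ η ^ 2 * (K * g) := by gcongr
    nlinarith [sq_nonneg (η ^ 2 * ut + 4 * η * c)]
  have a3 : η * ηt * u ^ 2 ≤ K * u ^ 2 := by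
    have : η * ηt ≤ K := by nlinarith
    gcongr
  have a4 : K * (- 2 * η * u * c) ≤ K * (1 / 2 * (η ^ 2 * g) + 2 * K * u ^ 2) := by
    have e1 : 0 ≤ (η * c + 2 * K * u) ^ 2 := sq_nonneg _
    have e2 : η ^ 2 * c ^ 2 ≤ η ^ 2 * (K * g) := by gcongr
    nlinarith
  have a5 := mul_le_mul_of_nonneg_left a3 hK
  nlinarith

end Energy

section Euclidean

variable {d : ℕ}

/-- The unit vector in the time direction. -/
noncomputable def timeDir (d : ℕ) : ℝ × EuclideanSpace ℝ (Fin d) := (1, 0)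

/-- The `i`-th unit vector in the space directions. -/
noncomputable def spaceDir (i : Fin d) : ℝ × EuclideanSpace ℝ (Fin d) :=
  (0, EuclideanSpace.single i 1)

/-- Energy estimate for the heat equation with a cutoff `η`, obtained by integrating the time
derivative of the energy density minus the divergence of its flux. -/
theorem caccioppoli_cutoff {η v : ℝ × EuclideanSpace ℝ (Fin d) → ℝ}
    (hη : ContDiff ℝ (⊤ : ℕ∞) η) (hv : ContDiff ℝ (⊤ : ℕ∞) v) {a : ℝ} (ha : a ≤ 0)
    {x₀ : EuclideanSpace ℝ (Fin d)} {R K : ℝ} (hK : 0 ≤ K)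
    (hη0 : ∀ p, 0 ≤ η p) (hη1 : ∀ p, η p ≤ 1)
    (hηa : ∀ x, η (a, x) = 0) (hηR : ∀ p : ℝ × EuclideanSpace ℝ (Fin d), R ≤ ‖p.2 - x₀‖ → η p = 0)
    (hηt : ∀ p ∈ Icc a 0 ×ˢ Metric.ball x₀ R, |dirDeriv (timeDir d) η p| ≤ K)
    (hηx : ∀ p ∈ Icc a 0 ×ˢ Metric.ball x₀ R, ∑ i, dirDeriv (spaceDir i) η p ^ 2 ≤ K)
    (heat : ∀ p ∈ Icc a 0 ×ˢ Metric.ball x₀ R, dirDeriv (timeDir d) v p =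
      ∑ i, dirDeriv (spaceDir i) (dirDeriv (spaceDir i) v) p) :
    ∫ p in Icc a 0 ×ˢ Metric.ball x₀ R, η p ^ 4 * dirDeriv (timeDir d) v p ^ 2
      ≤ 120 * K ^ 2 * ∫ p in Icc a 0 ×ˢ Metric.ball x₀ R, v p ^ 2 := by
  set A : ℝ := 20 * K with hA
  set vt := dirDeriv (timeDir d) v with hvt_def
  have hvt : ContDiff ℝ (⊤ : ℕ∞) vt := hv.dirDeriv _
  have hvi : ∀ i : Fin d, ContDiff ℝ (⊤ : ℕ∞) (dirDeriv (spaceDir i) v) := fun i => hv.dirDeriv _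
  let e : ℝ × EuclideanSpace ℝ (Fin d) → ℝ := fun q =>
    η q ^ 4 * (∑ i, dirDeriv (spaceDir i) v q ^ 2) / 2 + A * η q ^ 2 * v q ^ 2 / 2
  let F : Fin d → ℝ × EuclideanSpace ℝ (Fin d) → ℝ := fun i q =>
    η q ^ 4 * vt q * dirDeriv (spaceDir i) v q + A * η q ^ 2 * v q * dirDeriv (spaceDir i) v q
  have he : ContDiff ℝ (⊤ : ℕ∞) e := by
    have := ContDiff.sum (s := Finset.univ) fun i _ => (hvi i).pow 2
    exact (((hη.pow 4).mul this).div_const 2).add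
      (((contDiff_const.mul (hη.pow 2)).mul (hv.pow 2)).div_const 2)
  have hF : ∀ i, ContDiff ℝ (⊤ : ℕ∞) (F i) := fun i =>
    (((hη.pow 4).mul hvt).mul (hvi i)).add
      (((contDiff_const.mul (hη.pow 2)).mul hv).mul (hvi i))
  have he0 : ∀ p : ℝ × EuclideanSpace ℝ (Fin d), R < ‖p.2 - x₀‖ → e p = 0 := fun p hp => by
    simp [e, hηR p hp.le]
  have hF0 : ∀ i, ∀ p : ℝ × EuclideanSpace ℝ (Fin d), R < ‖p.2 - x₀‖ → F i p = 0 :=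
    fun i p hp => by simp [F, hηR p hp.le]
  let P : ℝ × EuclideanSpace ℝ (Fin d) → ℝ := fun p =>
    dirDeriv (timeDir d) e p - ∑ i, dirDeriv (spaceDir i) (F i) p
  have hPint : 0 ≤ ∫ p in Icc a 0 ×ˢ univ, P p := by
    have i1 : IntegrableOn (dirDeriv (timeDir d) e) (Icc a 0 ×ˢ univ) :=
      integrableOn_Icc_prod_univ (he.dirDeriv _).continuous
        (dirDeriv_eq_zero_of_forall_lt_norm he0 _) a 0
    have i2 : ∀ i, IntegrableOn (dirDeriv (spaceDir i) (F i)) (Icc a 0 ×ˢ univ) := fun i =>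
      integrableOn_Icc_prod_univ ((hF i).dirDeriv _).continuous
        (dirDeriv_eq_zero_of_forall_lt_norm (hF0 i) _) a 0
    rw [integral_sub i1 (integrable_finsetSum _ fun i _ => i2 i),
      integral_finsetSum _ fun i _ => i2 i,
      Finset.sum_eq_zero (f := fun i => ∫ p in Icc a 0 ×ˢ univ, dirDeriv (spaceDir i) (F i) p)
        fun i _ => setIntegral_dirDeriv_space_eq_zero (hF i) (hF0 i) a 0 _, sub_zero]
    refine setIntegral_dirDeriv_time_nonneg he he0 ha fun x => ?_
    have : e (a, x) = 0 := by simp [e, hηa x]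
    rw [this]
    positivity
  have hPeq : ∀ p, P p = η p * (2 * η p ^ 2 * dirDeriv (timeDir d) η p
        * (∑ i, dirDeriv (spaceDir i) v p ^ 2)
      - 4 * η p ^ 2 * vt p * (∑ i, dirDeriv (spaceDir i) η p * dirDeriv (spaceDir i) v p)
      - η p ^ 3 * vt p * (∑ i, dirDeriv (spaceDir i) (dirDeriv (spaceDir i) v) p)
      + A * (dirDeriv (timeDir d) η p * v p ^ 2 + η p * v p * vt p
        - 2 * v p * (∑ i, dirDeriv (spaceDir i) η p * dirDeriv (spaceDir i) v p)
        - η p * (∑ i, dirDeriv (spaceDir i) v p ^ 2)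
        - η p * v p * (∑ i, dirDeriv (spaceDir i) (dirDeriv (spaceDir i) v) p))) := by
    intro p
    simp only [P, e, F]
    rw [dirDeriv_energy hη hv]
    simp only [dirDeriv_flux hη hv hvt, Finset.sum_add_distrib, ← Finset.mul_sum, ← hvt_def]
    ring
  have hball : ∫ p in Icc a 0 ×ˢ univ, P p = ∫ p in Icc a 0 ×ˢ Metric.ball x₀ R, P p := by
    refine (setIntegral_eq_of_subset_of_forall_sdiff_eq_zero
      (measurableSet_Icc.prod MeasurableSet.univ) (prod_mono le_rfl (subset_univ _)) ?_)
    rintro p ⟨hp, hpn⟩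
    have : R ≤ ‖p.2 - x₀‖ := by
      by_contra hc
      exact hpn ⟨hp.1, by simpa [dist_eq_norm] using hc⟩
    rw [hPeq, hηR p this, zero_mul]
  have hcint : ∀ {g : ℝ × EuclideanSpace ℝ (Fin d) → ℝ}, Continuous g →
      IntegrableOn g (Icc a 0 ×ˢ Metric.ball x₀ R) := fun hg =>
    (hg.continuousOn.integrableOn_compact
      (isCompact_Icc.prod (isCompact_closedBall x₀ R))).mono_set
      (prod_mono le_rfl Metric.ball_subset_closedBall)
  have j1 := hcint (g := fun p => η p ^ 4 * vt p ^ 2)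
    ((hη.continuous.pow 4).mul (hvt.continuous.pow 2))
  have j2 := hcint (g := fun p => v p ^ 2) (hv.continuous.pow 2)
  have j3 : IntegrableOn P (Icc a 0 ×ˢ Metric.ball x₀ R) :=
    hcint ((he.dirDeriv _).continuous.sub
      (continuous_finsetSum _ fun i _ => ((hF i).dirDeriv _).continuous))
  have hle : ∫ p in Icc a 0 ×ˢ Metric.ball x₀ R, P p ≤ ∫ p in Icc a 0 ×ˢ Metric.ball x₀ R,
      (-(1 / 2) * (η p ^ 4 * vt p ^ 2) + 60 * K ^ 2 * v p ^ 2) := by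
    refine setIntegral_mono_on j3 ((j1.const_mul _).add (j2.const_mul _))
      (measurableSet_Icc.prod measurableSet_ball) fun p hp => ?_
    rw [hPeq, ← heat p hp]
    refine le_trans (le_of_eq ?_) (energy_dissipation_le (ut := vt p) (u := v p) hK (hη0 p) (hη1 p)
      (hηt p hp) (hηx p hp) (Finset.sum_nonneg fun i _ => sq_nonneg (dirDeriv (spaceDir i) v p))
      (Finset.sum_mul_sq_le_sq_mul_sq Finset.univ (fun i => dirDeriv (spaceDir i) η p)
        fun i => dirDeriv (spaceDir i) v p))
    rw [hA]; ring
  rw [integral_add (j1.const_mul _) (j2.const_mul _), integral_const_mul, integral_const_mul,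
    ← hball] at hle
  linarith

end Euclidean

section Localization

open scoped Topology Manifold ContDiff

/-- A function smooth on a neighborhood of a compact set agrees near that set with a globally
smooth function. -/
theorem exists_contDiff_eventuallyEq_of_isCompact {V : Type*} [NormedAddCommGroup V]
    [NormedSpace ℝ V] [FiniteDimensional ℝ V] {K U : Set V} (hK : IsCompact K) (hU : IsOpen U)
    (hKU : K ⊆ U) {f : V → ℝ} (hf : ContDiffOn ℝ (⊤ : ℕ∞) f U) :
    ∃ v : V → ℝ, ContDiff ℝ (⊤ : ℕ∞) v ∧ ∀ p ∈ K, v =ᶠ[𝓝 p] f := by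
  obtain ⟨K', hK', hKK', hK'U⟩ := exists_compact_between hK hU hKU
  obtain ⟨χ, hχ1, hχ0, -⟩ := exists_contMDiffMap_one_nhds_of_subset_interior
    (n := (⊤ : ℕ∞)) 𝓘(ℝ, V) hK.isClosed hKK'
  have hχ : ContDiff ℝ (⊤ : ℕ∞) χ := χ.contMDiff.contDiff
  refine ⟨fun p => χ p * f p, ?_, ?_⟩
  · rw [contDiff_iff_contDiffAt]
    intro p
    by_cases hp : p ∈ U
    · exact hχ.contDiffAt.mul (hf.contDiffAt (hU.mem_nhds hp))
    · have : (fun p => χ p * f p) =ᶠ[𝓝 p] fun _ => 0 := by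
        filter_upwards [hK'.isClosed.isOpen_compl.mem_nhds fun h => hp (hK'U h)] with q hq
        simp [hχ0 q hq]
      exact contDiffAt_const.congr_of_eventuallyEq this
  · intro p hp
    filter_upwards [hχ1.filter_mono (nhds_le_nhdsSet hp)] with q hq
    simp [hq]

variable {d : ℕ}

theorem deriv_slice_eq_dirDeriv {v : ℝ × EuclideanSpace ℝ (Fin d) → ℝ}
    (hv : ContDiff ℝ (⊤ : ℕ∞) v) {u : ℝ → EuclideanSpace ℝ (Fin d) → ℝ}
    {p : ℝ × EuclideanSpace ℝ (Fin d)} (h : v =ᶠ[𝓝 p] fun q => u q.1 q.2) :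
    deriv (fun s => u s p.2) p.1 = dirDeriv (timeDir d) v p := by
  have hc : Filter.Tendsto (fun s : ℝ => (s, p.2)) (𝓝 p.1) (𝓝 p) :=
    (by fun_prop : Continuous fun s : ℝ => (s, p.2)).tendsto' _ _ rfl
  have h1 : HasFDerivAt v (fderiv ℝ v p) (p.1, p.2) := (hv.differentiable (by simp) p).hasFDerivAt
  have h2 := h1.comp_hasDerivAt p.1 ((hasDerivAt_id p.1).prodMk (hasDerivAt_const p.1 p.2))
  have h3 : (fun s => v (s, p.2)) =ᶠ[𝓝 p.1] fun s => u s p.2 := hc.eventually h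
  exact (h2.congr_of_eventuallyEq h3.symm).deriv

theorem fderiv_slice_eq_dirDeriv {v : ℝ × EuclideanSpace ℝ (Fin d) → ℝ}
    (hv : ContDiff ℝ (⊤ : ℕ∞) v) {u : ℝ → EuclideanSpace ℝ (Fin d) → ℝ} {t : ℝ}
    {x : EuclideanSpace ℝ (Fin d)} (h : (fun y => v (t, y)) =ᶠ[𝓝 x] u t) (i : Fin d) :
    fderiv ℝ (u t) x (EuclideanSpace.single i 1) = dirDeriv (spaceDir i) v (t, x) := by
  have h1 : HasFDerivAt v (fderiv ℝ v (t, x)) (t, x) :=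
    (hv.differentiable (by simp) _).hasFDerivAt
  have h2 := h1.comp x (hasFDerivAt_prodMk_right t x)
  rw [(h2.congr_of_eventuallyEq h.symm).fderiv]
  simp [dirDeriv, spaceDir]

theorem lap_slice_eq_sum_dirDeriv {v : ℝ × EuclideanSpace ℝ (Fin d) → ℝ}
    (hv : ContDiff ℝ (⊤ : ℕ∞) v) {u : ℝ → EuclideanSpace ℝ (Fin d) → ℝ}
    {p : ℝ × EuclideanSpace ℝ (Fin d)} (h : v =ᶠ[𝓝 p] fun q => u q.1 q.2) :
    Lap (u p.1) p.2 = ∑ i, dirDeriv (spaceDir i) (dirDeriv (spaceDir i) v) p := by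
  have hc : Filter.Tendsto (fun y : EuclideanSpace ℝ (Fin d) => (p.1, y)) (𝓝 p.2) (𝓝 p) :=
    (by fun_prop : Continuous fun y : EuclideanSpace ℝ (Fin d) => (p.1, y)).tendsto' _ _ rfl
  have h1 : (fun y => v (p.1, y)) =ᶠ[𝓝 p.2] u p.1 := hc.eventually h
  refine Finset.sum_congr rfl fun i _ => ?_
  refine fderiv_slice_eq_dirDeriv (hv.dirDeriv (spaceDir i))
    (u := fun s y => fderiv ℝ (u s) y (EuclideanSpace.single i 1)) ?_ i
  filter_upwards [h1.eventuallyEq_nhds] with y hy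
  exact (fderiv_slice_eq_dirDeriv hv hy i).symm

end Localization

section Cutoff

theorem exists_abs_deriv_smoothTransition_le_s7 :
    ∃ M : ℝ, 0 < M ∧ ∀ x, |deriv smoothTransition x| ≤ M := by
  have hcd : Continuous (deriv smoothTransition) :=
    (smoothTransition.contDiff (n := 1)).continuous_deriv (by simp)
  have hcs : HasCompactSupport (deriv smoothTransition) := by
    refine HasCompactSupport.intro (isCompact_Icc (a := (0 : ℝ)) (b := 1)) fun x hx => ?_
    rcases lt_or_ge x 0 with h | h
    · have : smoothTransition =ᶠ[nhds x] fun _ => 0 := by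
        filter_upwards [Iio_mem_nhds h] with y hy
          using smoothTransition.zero_of_nonpos (le_of_lt hy)
      simp [this.deriv_eq]
    · have h1 : 1 < x := by
        by_contra hc
        exact hx ⟨h, not_lt.1 hc⟩
      have : smoothTransition =ᶠ[nhds x] fun _ => 1 := by
        filter_upwards [Ioi_mem_nhds h1] with y hy
          using smoothTransition.one_of_one_le (le_of_lt hy)
      simp [this.deriv_eq]
  obtain ⟨C, hC⟩ := hcs.exists_bound_of_continuous hcd
  exact ⟨max C 1, by positivity, fun x => (hC x).trans (le_max_left _ _)⟩

theorem exists_parabolic_cutoff (d : ℕ) :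
    ∃ N : ℝ, 0 < N ∧ ∀ (x₀ : EuclideanSpace ℝ (Fin d)) (k j : ℕ), 1 ≤ k →
      ∃ η : ℝ × EuclideanSpace ℝ (Fin d) → ℝ, ContDiff ℝ (⊤ : ℕ∞) η ∧
        (∀ p, 0 ≤ η p) ∧ (∀ p, η p ≤ 1) ∧ (∀ x, η (-((j : ℝ) + 1) / k, x) = 0) ∧
        (∀ p : ℝ × EuclideanSpace ℝ (Fin d), ((j : ℝ) + 1) / √k ≤ ‖p.2 - x₀‖ → η p = 0) ∧
        (∀ p : ℝ × EuclideanSpace ℝ (Fin d), ‖p.2 - x₀‖ < (j : ℝ) / √k → -(j : ℝ) / k ≤ p.1 →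
          η p = 1) ∧
        (∀ p, |dirDeriv (timeDir d) η p| ≤ N * k) ∧
        ∀ p : ℝ × EuclideanSpace ℝ (Fin d), ‖p.2 - x₀‖ < ((j : ℝ) + 1) / √k →
          ∑ i, dirDeriv (spaceDir i) η p ^ 2 ≤ N * k := by
  obtain ⟨M, hM, hM'⟩ := exists_abs_deriv_smoothTransition_le_s7
  refine ⟨M + 4 * M ^ 2, by positivity, fun x₀ k j hk => ?_⟩
  have hk0 : (0 : ℝ) < k := by exact_mod_cast hk
  have hj0 : (0 : ℝ) ≤ j := j.cast_nonneg
  have hsq : √(k : ℝ) ^ 2 = k := Real.sq_sqrt hk0.le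
  have hs0 : 0 < √(k : ℝ) := Real.sqrt_pos.2 hk0
  let τ : ℝ × EuclideanSpace ℝ (Fin d) → ℝ := fun p => k * p.1 + (j + 1)
  let σ : ℝ × EuclideanSpace ℝ (Fin d) → ℝ := fun p =>
    (((j : ℝ) + 1) ^ 2 - k * ‖p.2 - x₀‖ ^ 2) / (2 * j + 1)
  have hτ : ContDiff ℝ (⊤ : ℕ∞) τ := by fun_prop
  have hσ : ContDiff ℝ (⊤ : ℕ∞) σ := by
    have : ContDiff ℝ (⊤ : ℕ∞) fun p : ℝ × EuclideanSpace ℝ (Fin d) => ‖p.2 - x₀‖ ^ 2 :=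
      (contDiff_snd.sub contDiff_const).norm_sq ℝ
    exact (contDiff_const.sub (contDiff_const.mul this)).div_const _
  have hderiv : ∀ p w, dirDeriv w (fun p => smoothTransition (τ p) * smoothTransition (σ p)) p =
      smoothTransition (σ p) * (deriv smoothTransition (τ p) * (k * w.1)) +
      smoothTransition (τ p) * (deriv smoothTransition (σ p) *
        (-(k * (2 * inner ℝ (p.2 - x₀) w.2)) / (2 * j + 1))) := by
    intro p w
    have hρ : ∀ y, HasDerivAt smoothTransition (deriv smoothTransition y) y := fun y =>
      ((smoothTransition.contDiff (n := 1)).differentiable (by simp) y).hasDerivAt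
    have e1 : HasFDerivAt τ ((k : ℝ) • ContinuousLinearMap.fst ℝ ℝ _) p :=
      (hasFDerivAt_fst.const_mul (k : ℝ)).add_const _
    have e2 := ((((hasFDerivAt_snd (𝕜 := ℝ) (p := p)).sub_const x₀).norm_sq.const_mul
      (k : ℝ)).const_sub (((j : ℝ) + 1) ^ 2)).mul_const (1 / (2 * (j : ℝ) + 1))
    have e2' := e2.congr_of_eventuallyEq (f₁ := σ) (.of_forall fun q => by simp [σ]; ring)
    have e3 := ((hρ (τ p)).comp_hasFDerivAt p e1).mul ((hρ (σ p)).comp_hasFDerivAt p e2')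
    have e4 := (e3.congr_of_eventuallyEq
      (f₁ := fun p => smoothTransition (τ p) * smoothTransition (σ p))
      (.of_forall fun q => rfl)).fderiv
    rw [dirDeriv, e4]
    simp [inner_sub_left]
    ring
  have hbase : ∀ y, |smoothTransition y| ≤ 1 := fun y => by
    rw [abs_of_nonneg (smoothTransition.nonneg y)]; exact smoothTransition.le_one y
  refine ⟨fun p => smoothTransition (τ p) * smoothTransition (σ p), ?_, ?_, ?_, ?_, ?_, ?_, ?_, ?_⟩
  · exact (smoothTransition.contDiff.comp hτ).mul (smoothTransition.contDiff.comp hσ)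
  · exact fun p => mul_nonneg (smoothTransition.nonneg _) (smoothTransition.nonneg _)
  · exact fun p => mul_le_one₀ (smoothTransition.le_one _) (smoothTransition.nonneg _)
      (smoothTransition.le_one _)
  · intro x
    have : τ (-((j : ℝ) + 1) / k, x) = 0 := by
      simp only [τ]; field_simp; ring
    change smoothTransition (τ _) * _ = 0
    rw [smoothTransition.zero_of_nonpos this.le, zero_mul]
  · intro p hp
    rw [div_le_iff₀ hs0] at hp
    have h1 : ((j : ℝ) + 1) ^ 2 ≤ k * ‖p.2 - x₀‖ ^ 2 := by
      calc ((j : ℝ) + 1) ^ 2 ≤ (‖p.2 - x₀‖ * √k) ^ 2 := by gcongr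
        _ = _ := by rw [mul_pow, hsq]; ring
    have : σ p ≤ 0 := div_nonpos_of_nonpos_of_nonneg (by linarith) (by positivity)
    simp [smoothTransition.zero_of_nonpos this]
  · intro p hp ht
    rw [lt_div_iff₀ hs0] at hp
    rw [div_le_iff₀ hk0] at ht
    have h1 : k * ‖p.2 - x₀‖ ^ 2 ≤ (j : ℝ) ^ 2 := by
      calc k * ‖p.2 - x₀‖ ^ 2 = (‖p.2 - x₀‖ * √k) ^ 2 := by rw [mul_pow, hsq]; ring
        _ ≤ _ := by gcongr
    have h2 : 1 ≤ σ p := by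
      rw [le_div_iff₀ (by positivity)]; nlinarith
    have h3 : 1 ≤ τ p := by simp only [τ]; linarith
    simp [smoothTransition.one_of_one_le h2, smoothTransition.one_of_one_le h3]
  · intro p
    rw [hderiv]
    simp only [timeDir, inner_zero_right, mul_zero, neg_zero, zero_div, add_zero, mul_one, abs_mul,
      abs_of_pos hk0]
    calc |smoothTransition (σ p)| * (|deriv smoothTransition (τ p)| * k) ≤ 1 * (M * k) := by
          gcongr
          · exact hbase _
          · exact hM' _
      _ ≤ _ := by nlinarith [mul_pos (pow_pos hM 2) hk0]
  · intro p hp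
    rw [lt_div_iff₀ hs0] at hp
    have h1 : k * ‖p.2 - x₀‖ ^ 2 ≤ ((j : ℝ) + 1) ^ 2 := by
      calc k * ‖p.2 - x₀‖ ^ 2 = (‖p.2 - x₀‖ * √k) ^ 2 := by rw [mul_pow, hsq]; ring
        _ ≤ _ := by gcongr
    have h2 : ∀ i : Fin d,
        dirDeriv (spaceDir i) (fun p => smoothTransition (τ p) * smoothTransition (σ p)) p ^ 2 ≤
          M ^ 2 * (4 * k ^ 2 / (2 * j + 1) ^ 2) * (p.2 - x₀) i ^ 2 := by
      intro i
      rw [hderiv]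
      have : inner ℝ (p.2 - x₀) (EuclideanSpace.single i (1 : ℝ)) = (p.2 - x₀) i := by
        simp [EuclideanSpace.inner_single_right]
      simp only [spaceDir, this, mul_zero, zero_add]
      calc (smoothTransition (τ p) * (deriv smoothTransition (σ p) *
            (-(k * (2 * (p.2 - x₀) i)) / (2 * j + 1)))) ^ 2
          = |smoothTransition (τ p)| ^ 2 * |deriv smoothTransition (σ p)| ^ 2 *
            (4 * k ^ 2 / (2 * j + 1) ^ 2) * (p.2 - x₀) i ^ 2 := by
              rw [sq_abs, sq_abs]; field_simp; ring
        _ ≤ 1 ^ 2 * M ^ 2 * (4 * k ^ 2 / (2 * j + 1) ^ 2) * (p.2 - x₀) i ^ 2 := by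
              gcongr
              · exact hbase _
              · exact hM' _
        _ = _ := by ring
    have h3 : ∑ i, (p.2 - x₀) i ^ 2 = ‖p.2 - x₀‖ ^ 2 := by
      simp [EuclideanSpace.norm_sq_eq]
    calc _ ≤ ∑ i, M ^ 2 * (4 * k ^ 2 / (2 * j + 1) ^ 2) * (p.2 - x₀) i ^ 2 :=
          Finset.sum_le_sum fun i _ => h2 i
      _ = 4 * M ^ 2 * k * (k * ‖p.2 - x₀‖ ^ 2 / (2 * j + 1) ^ 2) := by
          rw [← Finset.mul_sum, h3]; field_simp
      _ ≤ 4 * M ^ 2 * k * 1 := by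
          gcongr
          rw [div_le_one (by positivity)]
          nlinarith
      _ ≤ _ := by nlinarith

end Cutoff

/-- For a smooth solution of the heat equation on (a neighborhood of) `[-1,0] × ℝ^d`, with
`Ω¹_j = {(t,x) : |x-x₀| < j/√k, t ∈ [-j/k,0]}`, one has
`∫_{Ω¹_j} (∂ₜu)² ≤ C₀ k² ∫_{Ω¹_{j+1}} u²`, where `C₀` depends only on `d`. -/
theorem caccioppoli_combined (d : ℕ) :
    ∃ C₀ > (0:ℝ),
      ∀ (u : ℝ → EuclideanSpace ℝ (Fin d) → ℝ),
      ∀ U : Set (ℝ × EuclideanSpace ℝ (Fin d)), IsOpen U →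
        (Set.Icc (-1:ℝ) 0 ×ˢ (Set.univ : Set (EuclideanSpace ℝ (Fin d)))) ⊆ U →
        ContDiffOn ℝ (⊤ : ℕ∞) (fun p : ℝ × EuclideanSpace ℝ (Fin d) => u p.1 p.2) U →
        (∀ p ∈ U, deriv (fun s => u s p.2) p.1 = Lap (u p.1) p.2) →
        ∀ (x₀ : EuclideanSpace ℝ (Fin d)) (k j : ℕ), 1 ≤ k → 1 ≤ j → j + 1 ≤ k →
        (∫ p in {p : ℝ × EuclideanSpace ℝ (Fin d) |
            ‖p.2 - x₀‖ < (j:ℝ) / Real.sqrt k ∧ p.1 ∈ Set.Icc (-(j:ℝ)/k) 0},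
          (deriv (fun s => u s p.2) p.1)^2 ∂volume)
        ≤ C₀ * k^2 * ∫ p in {p : ℝ × EuclideanSpace ℝ (Fin d) |
            ‖p.2 - x₀‖ < ((j:ℝ) + 1) / Real.sqrt k ∧ p.1 ∈ Set.Icc (-((j:ℝ)+1)/k) 0},
          (u p.1 p.2)^2 ∂volume := by
  obtain ⟨N, hN, hcut⟩ := exists_parabolic_cutoff d
  refine ⟨120 * N ^ 2, by positivity, ?_⟩
  intro u U hU hsub hu heat x₀ k j hk _ hjk
  obtain ⟨η, hη, hη0, hη1, hηa, hηR, hηone, hηt, hηx⟩ := hcut x₀ k j hk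
  have hk0 : (0 : ℝ) < k := by exact_mod_cast hk
  have hj0 : (0 : ℝ) ≤ j := j.cast_nonneg
  have hjk' : (j : ℝ) + 1 ≤ k := by exact_mod_cast hjk
  set a : ℝ := -((j : ℝ) + 1) / k with ha_def
  set R : ℝ := ((j : ℝ) + 1) / √k
  have ha0 : a ≤ 0 := div_nonpos_of_nonpos_of_nonneg (by linarith) hk0.le
  have ha1 : -1 ≤ a := by rw [ha_def, le_div_iff₀ hk0]; linarith
  have hset : ∀ (r b : ℝ), {p : ℝ × EuclideanSpace ℝ (Fin d) | ‖p.2 - x₀‖ < r ∧ p.1 ∈ Icc b 0} =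
      Icc b 0 ×ˢ Metric.ball x₀ r := fun r b => by
    ext p
    simp only [mem_ofPred_eq, mem_prod, mem_ball_iff_norm]
    exact and_comm
  have hKU : Icc a 0 ×ˢ Metric.closedBall x₀ R ⊆ U := fun p hp =>
    hsub ⟨⟨ha1.trans hp.1.1, hp.1.2⟩, mem_univ _⟩
  obtain ⟨v, hv, hvu⟩ := exists_contDiff_eventuallyEq_of_isCompact
    (isCompact_Icc.prod (isCompact_closedBall x₀ R)) hU hKU hu
  have hball : Icc a 0 ×ˢ Metric.ball x₀ R ⊆ Icc a 0 ×ˢ Metric.closedBall x₀ R :=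
    prod_mono le_rfl Metric.ball_subset_closedBall
  have hmain := caccioppoli_cutoff (K := N * k) hη hv ha0 (by positivity) hη0 hη1 hηa hηR
    (fun p _ => hηt p) (fun p hp => hηx p (mem_ball_iff_norm.1 hp.2)) (fun p hp => by
      have h := hvu p (hball hp)
      rw [← deriv_slice_eq_dirDeriv hv h, ← lap_slice_eq_sum_dirDeriv hv h]
      exact heat p (hKU (hball hp)))
  rw [hset, hset]
  have hsmall : Icc (-(j : ℝ) / k) 0 ×ˢ Metric.ball x₀ ((j : ℝ) / √k) ⊆
      Icc a 0 ×ˢ Metric.ball x₀ R := by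
    refine prod_mono (Icc_subset_Icc_left ?_) (Metric.ball_subset_ball ?_)
    · exact div_le_div_of_nonneg_right (by linarith) hk0.le
    · exact div_le_div_of_nonneg_right (by linarith) (Real.sqrt_nonneg _)
  have hint : IntegrableOn (fun p => η p ^ 4 * dirDeriv (timeDir d) v p ^ 2)
      (Icc a 0 ×ˢ Metric.ball x₀ R) :=
    (((hη.continuous.pow 4).mul ((hv.dirDeriv _).continuous.pow 2)).continuousOn.integrableOn_compact
      (isCompact_Icc.prod (isCompact_closedBall x₀ R))).mono_set hball
  calc ∫ p in Icc (-(j : ℝ) / k) 0 ×ˢ Metric.ball x₀ ((j : ℝ) / √k),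
        (deriv (fun s => u s p.2) p.1) ^ 2
      = ∫ p in Icc (-(j : ℝ) / k) 0 ×ˢ Metric.ball x₀ ((j : ℝ) / √k),
        η p ^ 4 * dirDeriv (timeDir d) v p ^ 2 := by
        refine setIntegral_congr_fun (measurableSet_Icc.prod measurableSet_ball) fun p hp => ?_
        simp only [hηone p (mem_ball_iff_norm.1 hp.2) hp.1.1,
          deriv_slice_eq_dirDeriv hv (hvu p (hball (hsmall hp))), one_pow, one_mul]
    _ ≤ ∫ p in Icc a 0 ×ˢ Metric.ball x₀ R, η p ^ 4 * dirDeriv (timeDir d) v p ^ 2 :=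
        setIntegral_mono_set hint (.of_forall fun p => by have := hη0 p; positivity)
          hsmall.eventuallyLE
    _ ≤ _ := hmain
    _ = _ := by
        rw [setIntegral_congr_fun (measurableSet_Icc.prod measurableSet_ball)
          fun p hp => congrArg (· ^ 2) (hvu p (hball hp)).eq_of_nhds]
        ring
end
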